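/- arXiv:1309.6080 — 7 statements merged into one kernel-verified Lean document; each statement's English description precedes it below -/
import Mathlib

section
/- For every γ > 0 and every τ ∈ ℝ, the Gaussian u_γ(r) = e^{−γ r²} satisfies the exact Rayleigh-quotient identity (∫₀^∞ (|u_γ'(r)|² + (r−τ)² |u_γ(r)|²) r dr) / (∫₀^∞ |u_γ(r)|² r dr) = 2γ + 1/(2γ) + τ² − τ √(π/(2γ)). -/
open MeasureTheory Set Real

theorem integrableOn_pow_mul_exp_neg_mul_sq {b : ℝ} (hb : 0 < b) (n : ℕ) :
    IntegrableOn (fun x : ℝ => x ^ n * Real.exp (-b * x ^ 2)) (Ioi 0) := by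
  have h := integrableOn_rpow_mul_exp_neg_mul_sq hb
    (lt_of_lt_of_le neg_one_lt_zero (Nat.cast_nonneg n))
  simpa only [rpow_natCast] using h

theorem integral_pow_mul_exp_neg_mul_sq {b : ℝ} (hb : 0 < b) (n : ℕ) :
    ∫ x in Ioi (0:ℝ), x ^ n * Real.exp (-b * x ^ 2) =
      b ^ (-((n:ℝ) + 1) / 2) * (1 / 2) * Real.Gamma (((n:ℝ) + 1) / 2) := by
  have h := integral_rpow_mul_exp_neg_mul_rpow two_pos
    (lt_of_lt_of_le neg_one_lt_zero (Nat.cast_nonneg n)) hb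
  simpa only [rpow_natCast, rpow_two] using h

theorem integral_id_mul_exp_neg_mul_sq {b : ℝ} (hb : 0 < b) :
    ∫ x in Ioi (0:ℝ), x ^ 1 * Real.exp (-b * x ^ 2) = 1 / (2 * b) := by
  rw [integral_pow_mul_exp_neg_mul_sq hb]
  norm_num [rpow_neg_one]

theorem integral_sq_mul_exp_neg_mul_sq {b : ℝ} (hb : 0 < b) :
    ∫ x in Ioi (0:ℝ), x ^ 2 * Real.exp (-b * x ^ 2) = √(π / b) / (4 * b) := by
  have hΓ : Real.Gamma (3 / 2) = √π / 2 := by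
    rw [show (3 / 2 : ℝ) = 1 / 2 + 1 by norm_num, Real.Gamma_add_one (by norm_num),
      Real.Gamma_one_half_eq]
    ring
  have hpow : b ^ (-(3 / 2) : ℝ) = b⁻¹ * (√b)⁻¹ := by
    rw [show (-(3 / 2) : ℝ) = -1 + -(1 / 2) by norm_num, rpow_add hb, rpow_neg_one,
      rpow_neg hb.le, sqrt_eq_rpow]
  rw [integral_pow_mul_exp_neg_mul_sq hb, show (((2 : ℕ) : ℝ) + 1) / 2 = 3 / 2 by norm_num,
    show -(((2 : ℕ) : ℝ) + 1) / 2 = -(3 / 2) by norm_num, hΓ, hpow, sqrt_div pi_pos.le]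
  ring

theorem integral_cube_mul_exp_neg_mul_sq {b : ℝ} (hb : 0 < b) :
    ∫ x in Ioi (0:ℝ), x ^ 3 * Real.exp (-b * x ^ 2) = 1 / (2 * b ^ 2) := by
  rw [integral_pow_mul_exp_neg_mul_sq hb, show (((3 : ℕ) : ℝ) + 1) / 2 = 2 by norm_num,
    show -(((3 : ℕ) : ℝ) + 1) / 2 = -2 by norm_num, rpow_neg hb.le, rpow_two, Real.Gamma_two]
  ring

theorem deriv_exp_neg_mul_sq (γ r : ℝ) :
    deriv (fun s : ℝ => Real.exp (-γ * s ^ 2)) r = -2 * γ * r * Real.exp (-γ * r ^ 2) := by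
  have h := (((hasDerivAt_id r).pow 2).const_mul (-γ)).exp.deriv
  simp only [Pi.pow_apply, id_eq] at h
  rw [h]
  push_cast
  ring

/-- Exact Rayleigh quotient of the Gaussian `u_γ(r) = e^{−γ r²}` for the quadratic form
`q_τ(u) = ∫₀^∞ (|u'(r)|² + (r−τ)²|u(r)|²) r dr` in the weighted space `L²_r(ℝ₊)`:
it equals `2γ + 1/(2γ) + τ² − τ √(π/(2γ))`. -/
theorem gaussian_rayleigh_quotient (γ : ℝ) (hγ : 0 < γ) (τ : ℝ) :
    (∫ r in Ioi (0:ℝ),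
        ((deriv (fun s : ℝ => Real.exp (-γ * s ^ 2)) r) ^ 2
          + (r - τ) ^ 2 * (Real.exp (-γ * r ^ 2)) ^ 2) * r) /
      (∫ r in Ioi (0:ℝ), (Real.exp (-γ * r ^ 2)) ^ 2 * r)
    = 2 * γ + 1 / (2 * γ) + τ ^ 2 - τ * Real.sqrt (π / (2 * γ)) := by
  have hb : 0 < 2 * γ := by positivity
  have hexp (r : ℝ) : Real.exp (-γ * r ^ 2) ^ 2 = Real.exp (-(2 * γ) * r ^ 2) := by
    rw [← Real.exp_nat_mul]
    congr 1
    push_cast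
    ring
  have hden : ∫ r in Ioi (0:ℝ), (Real.exp (-γ * r ^ 2)) ^ 2 * r = 1 / (2 * (2 * γ)) := by
    rw [← integral_id_mul_exp_neg_mul_sq hb]
    simp only [hexp, pow_one, mul_comm]
  have hnum : ∫ r in Ioi (0:ℝ), ((deriv (fun s : ℝ => Real.exp (-γ * s ^ 2)) r) ^ 2
          + (r - τ) ^ 2 * (Real.exp (-γ * r ^ 2)) ^ 2) * r =
      (4 * γ ^ 2 + 1) * (1 / (2 * (2 * γ) ^ 2))
        - 2 * τ * (√(π / (2 * γ)) / (4 * (2 * γ))) + τ ^ 2 * (1 / (2 * (2 * γ))) := by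
    have hI := integrableOn_pow_mul_exp_neg_mul_sq hb
    rw [← integral_id_mul_exp_neg_mul_sq hb, ← integral_sq_mul_exp_neg_mul_sq hb,
      ← integral_cube_mul_exp_neg_mul_sq hb, ← integral_const_mul, ← integral_const_mul,
      ← integral_const_mul, ← integral_sub ((hI 3).const_mul _) ((hI 2).const_mul _),
      ← integral_add ?_ ((hI 1).const_mul _)]
    · congr 1 with r
      rw [deriv_exp_neg_mul_sq, mul_pow, hexp]
      ring
    · exact ((hI 3).const_mul _).sub ((hI 2).const_mul _)
  rw [hnum, hden]
  field_simp
  ring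
end

section
/- Let τ ∈ ℝ, ζ ∈ ℝ, and let u : (0,∞) → ℝ be twice continuously differentiable, satisfying the singular ODE −r u''(r) − u'(r) + r (r−τ)² u(r) = ζ r u(r) for all r > 0, with ∫₀^∞ |u(r)|² r dr < ∞, ∫₀^∞ |u'(r)|² r dr < ∞, and lim_{r→0⁺} r u'(r) = 0. Then u extends to a real-analytic function on all of ℝ; moreover the extension v satisfies the Neumann condition v'(0) = 0. -/
open MeasureTheory Set Filter

/-- A coefficient sequence whose power series converges absolutely everywhere. -/
def IsEntireCoeff (a : ℕ → ℝ) : Prop := ∀ R : ℝ, 0 ≤ R → Summable fun n => |a n| * R ^ n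

namespace IsEntireCoeff

variable {a : ℕ → ℝ}

theorem of_bounded (h : ∀ R : ℝ, 0 ≤ R → ∃ C, ∀ n, |a n| * R ^ n ≤ C) : IsEntireCoeff a := by
  intro R hR
  obtain ⟨C, hC⟩ := h (2 * R) (by positivity)
  refine Summable.of_nonneg_of_le (fun n => by positivity) (fun n => ?_)
    ((summable_geometric_two).mul_left C)
  have h1 := hC n
  rw [mul_pow] at h1
  have h2 : |a n| * R ^ n = (|a n| * (2 ^ n * R ^ n)) * (1 / 2) ^ n := by
    rw [one_div, inv_pow]; field_simp
  rw [h2]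
  gcongr

theorem bounded (ha : IsEntireCoeff a) {R : ℝ} (hR : 0 ≤ R) : ∃ C, ∀ n, |a n| * R ^ n ≤ C :=
  ⟨_, fun n => (ha R hR).le_tsum n fun _ _ => by positivity⟩

theorem succ (ha : IsEntireCoeff a) : IsEntireCoeff fun n => a (n + 1) := by
  refine of_bounded fun R hR => ?_
  obtain ⟨C, hC⟩ := ha.bounded (R := R + 1) (by positivity)
  refine ⟨C, fun n => le_trans ?_ (hC (n + 1))⟩
  gcongr
  calc R ^ n ≤ (R + 1) ^ n := by gcongr; linarith
    _ ≤ (R + 1) ^ (n + 1) := pow_le_pow_right₀ (by linarith) (by omega)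

theorem deriv_coeff (ha : IsEntireCoeff a) : IsEntireCoeff fun n => (n + 1) * a (n + 1) := by
  refine of_bounded fun R hR => ?_
  obtain ⟨C, hC⟩ := ha.succ.bounded (R := 2 * R) (by positivity)
  refine ⟨C, fun n => le_trans ?_ (hC n)⟩
  have h2 : ((n : ℝ) + 1) ≤ 2 ^ n := by exact_mod_cast Nat.lt_two_pow_self (n := n)
  rw [abs_mul, abs_of_nonneg (by positivity : (0 : ℝ) ≤ n + 1), mul_pow]
  calc (n + 1) * |a (n + 1)| * R ^ n ≤ 2 ^ n * |a (n + 1)| * R ^ n := by gcongr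
    _ = _ := by ring

theorem summable (ha : IsEntireCoeff a) (x : ℝ) : Summable fun n => a n * x ^ n := by
  refine Summable.of_norm ?_
  simpa [abs_mul, abs_pow] using ha |x| (abs_nonneg x)

theorem hasDerivAt (ha : IsEntireCoeff a) (x : ℝ) :
    HasDerivAt (fun y => ∑' n, a n * y ^ n) (∑' n, (n + 1) * a (n + 1) * x ^ n) x := by
  have hx : x ∈ Metric.ball (0 : ℝ) (|x| + 1) := by simp
  have hb := ha.deriv_coeff (|x| + 1) (by positivity)
  have key := hasDerivAt_tsum_of_isPreconnected (𝕜 := ℝ) (t := Metric.ball (0 : ℝ) (|x| + 1))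
    (g := fun n y => a n * y ^ n) (g' := fun n y => a n * (n * y ^ (n - 1)))
    (u := fun n => |a n| * (n * (|x| + 1) ^ (n - 1))) ?_ Metric.isOpen_ball
    (convex_ball _ _).isPreconnected (fun n y _ => (hasDerivAt_pow n y).const_mul (a n)) ?_
    hx (ha.summable x) hx
  · refine key.congr_deriv ?_
    have hs : Summable fun n : ℕ => a n * (n * x ^ (n - 1)) := by
      refine (summable_nat_add_iff 1).1 ((ha.deriv_coeff.summable x).congr fun n => ?_)
      rw [Nat.add_sub_cancel]
      push_cast
      ring
    rw [hs.tsum_eq_zero_add]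
    simp only [Nat.cast_zero, zero_mul, mul_zero, zero_add]
    refine tsum_congr fun n => ?_
    rw [Nat.add_sub_cancel]
    push_cast
    ring
  · refine (summable_nat_add_iff 1).1 (hb.congr fun n => ?_)
    rw [abs_mul, abs_of_nonneg (by positivity : (0 : ℝ) ≤ n + 1)]
    rw [Nat.add_sub_cancel]
    push_cast
    ring
  · intro n y hy
    have hy' : |y| ≤ |x| + 1 := by simpa using (Metric.mem_ball.1 hy).le
    rw [Real.norm_eq_abs, abs_mul, abs_mul, abs_pow, Nat.abs_cast]
    gcongr

theorem analyticAt (ha : IsEntireCoeff a) (x : ℝ) :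
    AnalyticAt ℝ (fun y => ∑' n, a n * y ^ n) x := by
  have hr : (FormalMultilinearSeries.ofScalars ℝ a).radius = ⊤ := by
    refine FormalMultilinearSeries.radius_eq_top_of_summable_norm _ fun r => ?_
    simpa [FormalMultilinearSeries.ofScalars_norm] using ha r r.2
  have h := (FormalMultilinearSeries.ofScalars ℝ a).hasFPowerSeriesOnBall (by simp [hr])
  rw [hr] at h
  have := h.analyticAt_of_mem (y := x) (by simp)
  convert! this using 1
  ext y
  exact (FormalMultilinearSeries.ofScalars_sum_eq a y).symm

end IsEntireCoeff

/-- Coefficients of the Frobenius solution at `0` of `r w'' + w' = r (q₀ + q₁ r + q₂ r²) w`,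
shifted by three places so that the recurrence needs no initial cases. -/
noncomputable def frobeniusCoeff (q₀ q₁ q₂ : ℝ) : ℕ → ℝ
  | 0 => 0
  | 1 => 0
  | 2 => 0
  | 3 => 1
  | n + 4 => (q₀ * frobeniusCoeff q₀ q₁ q₂ (n + 2) + q₁ * frobeniusCoeff q₀ q₁ q₂ (n + 1)
      + q₂ * frobeniusCoeff q₀ q₁ q₂ n) / (n + 1) ^ 2

theorem isEntireCoeff_frobeniusCoeff (q₀ q₁ q₂ : ℝ) :
    IsEntireCoeff (frobeniusCoeff q₀ q₁ q₂) := by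
  refine .of_bounded fun R hR => ?_
  set c := frobeniusCoeff q₀ q₁ q₂ with hc
  set Q := |q₀| * R ^ 2 + |q₁| * R ^ 3 + |q₂| * R ^ 4 with hQ
  have hQ0 : 0 ≤ Q := by positivity
  obtain ⟨N, hN⟩ := exists_nat_ge Q
  have hterm : ∀ n, 0 ≤ |c n| * R ^ n := fun n => by positivity
  refine ⟨∑ i ∈ Finset.range (N + 4), |c i| * R ^ i, fun n => ?_⟩
  set C := ∑ i ∈ Finset.range (N + 4), |c i| * R ^ i
  have hC0 : 0 ≤ C := Finset.sum_nonneg fun i _ => hterm i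
  induction n using Nat.strong_induction_on with
  | _ n ih =>
    by_cases hn : n < N + 4
    · exact Finset.single_le_sum (f := fun i => |c i| * R ^ i) (fun i _ => hterm i)
        (Finset.mem_range.2 hn)
    · obtain ⟨m, rfl⟩ : ∃ m, n = m + 4 := ⟨n - 4, by omega⟩
      have hm : (N : ℝ) ≤ m := by exact_mod_cast (by omega : N ≤ m)
      have h0 := ih m (by omega)
      have h1 := ih (m + 1) (by omega)
      have h2 := ih (m + 2) (by omega)
      have hrec : c (m + 4) = (q₀ * c (m + 2) + q₁ * c (m + 1) + q₂ * c m) / (m + 1) ^ 2 := by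
        rw [hc, frobeniusCoeff]
      have hpos : (0 : ℝ) < (m + 1) ^ 2 := by positivity
      rw [hrec, abs_div, abs_of_pos hpos, div_mul_eq_mul_div, div_le_iff₀ hpos]
      have habs : |q₀ * c (m + 2) + q₁ * c (m + 1) + q₂ * c m| ≤
          |q₀| * |c (m + 2)| + |q₁| * |c (m + 1)| + |q₂| * |c m| := by
        simpa only [abs_mul] using abs_add_three (q₀ * c (m + 2)) (q₁ * c (m + 1)) (q₂ * c m)
      calc |q₀ * c (m + 2) + q₁ * c (m + 1) + q₂ * c m| * R ^ (m + 4)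
          ≤ (|q₀| * |c (m + 2)| + |q₁| * |c (m + 1)| + |q₂| * |c m|) * R ^ (m + 4) := by gcongr
        _ = |q₀| * R ^ 2 * (|c (m + 2)| * R ^ (m + 2)) + |q₁| * R ^ 3 *
              (|c (m + 1)| * R ^ (m + 1)) + |q₂| * R ^ 4 * (|c m| * R ^ m) := by ring
        _ ≤ |q₀| * R ^ 2 * C + |q₁| * R ^ 3 * C + |q₂| * R ^ 4 * C := by gcongr
        _ = C * Q := by rw [hQ]; ring
        _ ≤ C * (m + 1) ^ 2 := by gcongr; nlinarith

/-- The regular singular equation `r w'' + w' = r q(r) w`, with `q` a quadratic polynomial, has an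
entire solution with `w(0) = 1` and `w'(0) = 0`. -/
theorem exists_entire_frobenius_solution (q₀ q₁ q₂ : ℝ) :
    ∃ w w' w'' : ℝ → ℝ, (∀ x, AnalyticAt ℝ w x) ∧ (∀ x, HasDerivAt w (w' x) x) ∧
      (∀ x, HasDerivAt w' (w'' x) x) ∧ w 0 = 1 ∧ w' 0 = 0 ∧
      ∀ x, x * w'' x + w' x = x * (q₀ + q₁ * x + q₂ * x ^ 2) * w x := by
  set c := frobeniusCoeff q₀ q₁ q₂ with hc
  have hE0 : IsEntireCoeff c := isEntireCoeff_frobeniusCoeff q₀ q₁ q₂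
  have hE1 := hE0.succ
  have hE2 := hE1.succ
  have ha := hE2.succ
  have ha' := ha.deriv_coeff
  have ha'' := ha'.deriv_coeff
  have c0 : c 0 = 0 := by rw [hc, frobeniusCoeff]
  have c1 : c 1 = 0 := by rw [hc, frobeniusCoeff]
  have c2 : c 2 = 0 := by rw [hc, frobeniusCoeff]
  have c3 : c 3 = 1 := by rw [hc, frobeniusCoeff]
  have hrec : ∀ n : ℕ, (n + 1) ^ 2 * c (n + 4) = q₀ * c (n + 2) + q₁ * c (n + 1) + q₂ * c n := by
    intro n
    rw [hc, frobeniusCoeff, mul_div_cancel₀]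
    positivity
  have eval_zero : ∀ b : ℕ → ℝ, ∑' n, b n * (0 : ℝ) ^ n = b 0 := by
    intro b
    rw [tsum_eq_single 0 fun n hn => by simp [hn]]
    simp
  have sum_congr : ∀ {f g : ℕ → ℝ} {t : ℝ}, HasSum f t → (∀ n, g n = f n) → HasSum g t :=
    fun hf h => by rwa [funext h]
  have shift : ∀ (b : ℕ → ℝ) (x t : ℝ), HasSum (fun n => b (n + 1) * x ^ n) t → b 0 = 0 →
      HasSum (fun n => b n * x ^ n) (x * t) := by
    intro b x t hb hb0
    rw [← hasSum_nat_add_iff' 1]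
    simp only [Finset.range_one, Finset.sum_singleton, hb0, zero_mul, sub_zero]
    exact sum_congr (hb.mul_left x) fun n => by ring
  refine ⟨_, _, _, ha.analyticAt, ha.hasDerivAt, ha'.hasDerivAt, ?_, ?_, fun x => ?_⟩
  · rw [eval_zero fun n => c (n + 1 + 1 + 1)]
    exact c3
  · rw [eval_zero fun n => (n + 1) * c (n + 1 + 1 + 1 + 1)]
    have := hrec 0
    simp only [Nat.cast_zero, zero_add, one_pow, one_mul, c0, c1, c2, mul_zero, add_zero] at this
    simp [this]
  · have h3 := (ha.summable x).hasSum
    have h2 := shift (fun n => c (n + 2)) x _ h3 c2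
    have h1 := shift (fun n => c (n + 1)) x _ h2 c1
    have h0 := shift c x _ h1 c0
    have hd := (ha'.summable x).hasSum
    have hdd := shift (fun n => n * ((n + 1) * c (n + 4))) x _
      (sum_congr (ha''.summable x).hasSum fun n => by push_cast; ring) (by simp)
    have hl := hdd.add hd
    have hr := ((h2.mul_left q₀).add (h1.mul_left q₁)).add (h0.mul_left q₂)
    refine (hl.unique (sum_congr hr fun n => ?_)).trans (by ring)
    linear_combination x ^ n * hrec n

/-- Uniqueness for the initial value problem of a homogeneous linear second-order equation with
continuous coefficients on a half-line. -/
theorem eqOn_Ioi_of_linear_ode {p q f f' g g' : ℝ → ℝ} {l r₀ : ℝ} (hp : ContinuousOn p (Ioi l))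
    (hq : ContinuousOn q (Ioi l)) (hf : ∀ r ∈ Ioi l, HasDerivAt f (f' r) r)
    (hf' : ∀ r ∈ Ioi l, HasDerivAt f' (p r * f' r + q r * f r) r)
    (hg : ∀ r ∈ Ioi l, HasDerivAt g (g' r) r)
    (hg' : ∀ r ∈ Ioi l, HasDerivAt g' (p r * g' r + q r * g r) r)
    (hr₀ : l < r₀) (h0 : f r₀ = g r₀) (h1 : f' r₀ = g' r₀) : EqOn f g (Ioi l) := by
  intro r (hr : l < r)
  obtain ⟨a, hla, ha⟩ := exists_between (lt_min hr hr₀)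
  obtain ⟨b, hb⟩ := exists_gt (max r r₀)
  rw [lt_min_iff] at ha
  rw [max_lt_iff] at hb
  have hsub : Icc a b ⊆ Ioi l := fun t ht => lt_of_lt_of_le hla ht.1
  obtain ⟨P, hP⟩ := isCompact_Icc.exists_bound_of_continuousOn (hp.mono hsub)
  obtain ⟨Q, hQ⟩ := isCompact_Icc.exists_bound_of_continuousOn (hq.mono hsub)
  have hP0 : 0 ≤ P := (norm_nonneg _).trans (hP r ⟨ha.1.le, hb.1.le⟩)
  have hQ0 : 0 ≤ Q := (norm_nonneg _).trans (hQ r ⟨ha.1.le, hb.1.le⟩)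
  have key := ODE_solution_unique_of_mem_Ioo (a := a) (b := b) (t₀ := r₀)
    (v := fun t (y : ℝ × ℝ) => (y.2, p t * y.2 + q t * y.1)) (s := fun _ => univ)
    (K := ⟨1 + P + Q, by positivity⟩) (f := fun t => (f t, f' t)) (g := fun t => (g t, g' t))
    ?_ ⟨ha.2, hb.2⟩
    (fun t ht => ⟨(hf t (hla.trans ht.1)).prodMk (hf' t (hla.trans ht.1)), mem_univ _⟩)
    (fun t ht => ⟨(hg t (hla.trans ht.1)).prodMk (hg' t (hla.trans ht.1)), mem_univ _⟩)
    (by simp [h0, h1])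
  · exact congrArg Prod.fst (key ⟨ha.1, hb.1⟩)
  · intro t ht
    refine LipschitzOnWith.of_dist_le_mul fun y _ z _ => ?_
    have hpt := hP t (Ioo_subset_Icc_self ht)
    have hqt := hQ t (Ioo_subset_Icc_self ht)
    rw [Real.norm_eq_abs] at hpt hqt
    have d1 : |y.1 - z.1| ≤ dist y z := by
      rw [Prod.dist_eq]; exact le_max_left _ _
    have d2 : |y.2 - z.2| ≤ dist y z := by
      rw [Prod.dist_eq]; exact le_max_right _ _
    have d0 : 0 ≤ dist y z := dist_nonneg
    change dist _ _ ≤ (1 + P + Q) * dist y z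
    rw [Prod.dist_eq (x := (y.2, p t * y.2 + q t * y.1))]
    refine max_le ?_ ?_
    · change |y.2 - z.2| ≤ _
      nlinarith [mul_nonneg hP0 d0, mul_nonneg hQ0 d0]
    · change |p t * y.2 + q t * y.1 - (p t * z.2 + q t * z.1)| ≤ _
      calc |p t * y.2 + q t * y.1 - (p t * z.2 + q t * z.1)|
          = |p t * (y.2 - z.2) + q t * (y.1 - z.1)| := by congr 1; ring
        _ ≤ |p t| * |y.2 - z.2| + |q t| * |y.1 - z.1| := by
          simpa only [abs_mul] using abs_add_le (p t * (y.2 - z.2)) (q t * (y.1 - z.1))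
        _ ≤ P * dist y z + Q * dist y z := by gcongr
        _ ≤ (1 + P + Q) * dist y z := by nlinarith

/-- If `r u'(r) → 0` as `r → 0⁺`, then `r u(r)` stays bounded near `0`. -/
theorem exists_bound_mul_of_tendsto_mul_deriv {u u' : ℝ → ℝ}
    (hu : ∀ r ∈ Ioi (0 : ℝ), HasDerivAt u (u' r) r)
    (hlim : Tendsto (fun r => r * u' r) (nhdsWithin 0 (Ioi 0)) (nhds 0)) :
    ∃ C, ∀ᶠ r in nhdsWithin (0 : ℝ) (Ioi 0), |r * u r| ≤ C := by
  have h1 : ∀ᶠ r in nhdsWithin (0 : ℝ) (Ioi 0), |r * u' r| < 1 :=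
    hlim.abs.eventually (gt_mem_nhds (show |(0 : ℝ)| < 1 by simp))
  obtain ⟨δ, hδ, h⟩ := mem_nhdsGT_iff_exists_Ioc_subset.1 h1
  rw [mem_Ioi] at hδ
  refine ⟨δ * |u δ| + δ, ?_⟩
  filter_upwards [Ioo_mem_nhdsGT hδ] with r hr
  have hmv : ‖u δ - u r‖ ≤ 1 / r * (δ - r) := by
    refine norm_image_sub_le_of_norm_deriv_le_segment' (f' := u')
      (fun x hx => (hu x (hr.1.trans_le hx.1)).hasDerivWithinAt) (fun x hx => ?_)
      δ ⟨hr.2.le, le_rfl⟩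
    have hx0 : 0 < x := hr.1.trans_le hx.1
    have h2 : |x * u' x| < 1 := h ⟨hx0, hx.2.le⟩
    rw [abs_mul, abs_of_pos hx0] at h2
    rw [Real.norm_eq_abs, le_div_iff₀ hr.1]
    nlinarith [abs_nonneg (u' x), hx.1]
  rw [Real.norm_eq_abs, div_mul_eq_mul_div, one_mul, le_div_iff₀ hr.1] at hmv
  rw [abs_mul, abs_of_pos hr.1]
  have h3 : |u r| ≤ |u δ| + |u δ - u r| := by
    have := abs_sub_abs_le_abs_sub (u r) (u δ)
    rw [abs_sub_comm (u r)] at this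
    linarith
  have h4 := mul_le_mul_of_nonneg_left h3 hr.1.le
  nlinarith [abs_nonneg (u δ), hr.1, hr.2]

/-- Any solution of the singular ODE `−r u'' − u' + r(r−τ)² u = ζ r u` on `(0,∞)`
which lies in the domain of `𝔤(τ)` (square integrability for the weight `r dr` and
`r u'(r) → 0` as `r → 0⁺`) extends to a real-analytic function on `ℝ`, and the
extension satisfies the Neumann condition `v'(0) = 0`. -/
theorem eigenfunction_analytic_extension (τ ζ : ℝ) (u : ℝ → ℝ)
    (hu : ContDiffOn ℝ 2 u (Ioi 0))
    (hode : ∀ r ∈ Ioi (0:ℝ),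
      -(r * deriv (deriv u) r) - deriv u r + r * (r - τ) ^ 2 * u r = ζ * r * u r)
    (hL2 : IntegrableOn (fun r => u r ^ 2 * r) (Ioi 0))
    (hL2' : IntegrableOn (fun r => (deriv u r) ^ 2 * r) (Ioi 0))
    (hlim : Tendsto (fun r => r * deriv u r) (nhdsWithin 0 (Ioi 0)) (nhds 0)) :
    ∃ v : ℝ → ℝ, (∀ x : ℝ, AnalyticAt ℝ v x) ∧ (∀ r ∈ Ioi (0:ℝ), v r = u r) ∧
      deriv v 0 = 0 := by
  obtain ⟨w, w', w'', hwan, hw, hw', hw0, hw'0, hwode⟩ :=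
    exists_entire_frobenius_solution (τ ^ 2 - ζ) (-2 * τ) 1
  have hu1 : ∀ r ∈ Ioi (0 : ℝ), HasDerivAt u (deriv u r) r := fun r hr =>
    ((hu.differentiableOn (by norm_num)).differentiableAt (isOpen_Ioi.mem_nhds hr)).hasDerivAt
  have hu2 : ∀ r ∈ Ioi (0 : ℝ), HasDerivAt (deriv u) (deriv (deriv u) r) r := fun r hr =>
    (((hu.deriv_of_isOpen (m := 1) isOpen_Ioi (by norm_num)).differentiableOn
      (by norm_num)).differentiableAt (isOpen_Ioi.mem_nhds hr)).hasDerivAt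
  have hWderiv : ∀ r ∈ Ioi (0 : ℝ),
      HasDerivAt (fun r => r * (w r * deriv u r - u r * w' r)) 0 r := by
    intro r hr
    refine ((hasDerivAt_id' r).mul (((hw r).mul (hu2 r hr)).sub
      ((hu1 r hr).mul (hw' r)))).congr_deriv ?_
    have h1 := hode r hr
    have h2 := hwode r
    simp only [Pi.mul_apply, Pi.sub_apply]
    linear_combination -w r * h1 - u r * h2
  obtain ⟨C, hC⟩ := exists_bound_mul_of_tendsto_mul_deriv hu1 hlim
  have hw'cont : Tendsto w' (nhdsWithin 0 (Ioi 0)) (nhds 0) := by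
    simpa only [hw'0] using (hw' 0).continuousAt.tendsto.mono_left nhdsWithin_le_nhds
  have hwcont : Tendsto w (nhdsWithin 0 (Ioi 0)) (nhds 1) := by
    simpa only [hw0] using (hw 0).continuousAt.tendsto.mono_left nhdsWithin_le_nhds
  have hWlim : Tendsto (fun r => r * (w r * deriv u r - u r * w' r))
      (nhdsWithin 0 (Ioi 0)) (nhds 0) := by
    have h1 : Tendsto (fun r => w' r * (r * u r)) (nhdsWithin 0 (Ioi 0)) (nhds 0) :=
      hw'cont.zero_mul_isBoundedUnder_le (isBoundedUnder_of_eventually_le hC)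
    have h2 := (hwcont.mul hlim).sub h1
    rw [mul_zero, sub_zero] at h2
    exact h2.congr fun r => by ring
  obtain ⟨r₀, hwr₀, hr₀⟩ := ((hwcont.eventually (lt_mem_nhds zero_lt_one)).and
    self_mem_nhdsWithin).exists
  have hW : w r₀ * deriv u r₀ - u r₀ * w' r₀ = 0 := by
    have hconst : ∀ r ∈ Ioi (0 : ℝ), r * (w r * deriv u r - u r * w' r) =
        r₀ * (w r₀ * deriv u r₀ - u r₀ * w' r₀) := fun r hr =>
      isOpen_Ioi.is_const_of_deriv_eq_zero isPreconnected_Ioi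
        (fun x hx => (hWderiv x hx).differentiableAt.differentiableWithinAt)
        (fun x hx => (hWderiv x hx).deriv) hr hr₀
    have h1 := hWlim.congr' (eventually_mem_nhdsWithin.mono hconst)
    have h2 := tendsto_nhds_unique tendsto_const_nhds h1
    exact (mul_eq_zero.1 h2).resolve_left (ne_of_gt hr₀)
  set c := u r₀ / w r₀ with hc
  have hcw : c * w r₀ = u r₀ := div_mul_cancel₀ _ hwr₀.ne'
  have hcw' : c * w' r₀ = deriv u r₀ := by
    rw [hc, div_mul_eq_mul_div, div_eq_iff hwr₀.ne']
    linarith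
  refine ⟨fun x => c * w x, fun x => analyticAt_const.mul (hwan x), ?_, ?_⟩
  · refine eqOn_Ioi_of_linear_ode (p := fun r => -r⁻¹) (q := fun r => (r - τ) ^ 2 - ζ)
      (f' := fun x => c * w' x) (g' := deriv u)
      (continuousOn_inv₀.mono fun r hr => ne_of_gt hr).neg (by fun_prop)
      (fun r _ => (hw r).const_mul c) (fun r hr => ?_) hu1 (fun r hr => ?_) hr₀ hcw hcw'
    · refine ((hw' r).const_mul c).congr_deriv ?_
      have hr' : r ≠ 0 := ne_of_gt hr
      field_simp
      linear_combination c * hwode r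
    · refine (hu2 r hr).congr_deriv ?_
      have hr' : r ≠ 0 := ne_of_gt hr
      field_simp
      linear_combination -hode r hr
  · simpa [hw'0] using ((hw 0).const_mul c).deriv
end

section
/- Let I ⊂ ℝ be an open interval, ζ : I → ℝ, and z : I × (0,∞) → ℝ be continuously differentiable in τ and twice continuously differentiable in r, such that for every τ ∈ I: (i) z(τ,·) solves −∂_r² z(τ,r) − (1/r) ∂_r z(τ,r) + (r−τ)² z(τ,r) = ζ(τ) z(τ,r) for all r > 0; (ii) ∫₀^∞ z(τ,r)² r dr = 1; (iii) z(τ,·) and ∂_r z(τ,·) extend continuously to [0,∞) with ∂_r z(τ,0) = 0, and there exist constants C, c > 0 (locally uniform in τ) with |z(τ,r)| + |∂_r z(τ,r)| + |∂_τ z(τ,r)| ≤ C e^{−c r} for r ≥ 1. Then ζ is differentiable on I and for every τ ∈ I, ζ'(τ) = ∫₀^∞ ( −∂_r² z(τ,r) + ((r−τ)² − ζ(τ)) z(τ,r) ) z(τ,r) dr, i.e. ζ'(τ) = ⟨(𝔥₀^N(τ) − ζ(τ)) z(τ,·), z(τ,·)⟩ in the unweighted space L²(ℝ₊). -/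
open MeasureTheory Set Filter

section L2Convergence

variable {α ι : Type*} [MeasurableSpace α] {μ : Measure α} {l : Filter ι}
  [l.IsCountablyGenerated] {F : ι → α → ℝ} {f h : α → ℝ}

/-- Truncation of a product `(F i - f) * h` at level `C * h ^ 2`: its integral tends to `0` when
`F i` tends to `f` pointwise almost everywhere. -/
lemma tendsto_integral_min_abs_sub_mul (hF : ∀ᶠ i in l, AEStronglyMeasurable (F i) μ)
    (hf : AEStronglyMeasurable f μ) (hh : MemLp h 2 μ) {C : ℝ} (hC : 0 ≤ C)
    (hlim : ∀ᵐ x ∂μ, Tendsto (fun i => F i x) l (nhds (f x))) :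
    Tendsto (fun i => ∫ x, min |(F i x - f x) * h x| (C * h x ^ 2) ∂μ) l (nhds 0) := by
  have key : Tendsto (fun i => ∫ x, min |(F i x - f x) * h x| (C * h x ^ 2) ∂μ) l
      (nhds (∫ _, (0 : ℝ) ∂μ)) := by
    refine tendsto_integral_filter_of_dominated_convergence (fun x => C * h x ^ 2) ?_ ?_
      (hh.integrable_sq.const_mul C) ?_
    · filter_upwards [hF] with i hi
      exact ((hi.sub hf).mul hh.1).norm.inf ((hh.1.pow 2).const_mul C)
    · refine Eventually.of_forall fun i => Eventually.of_forall fun x => ?_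
      rw [Real.norm_of_nonneg (le_min (abs_nonneg _) (by positivity))]
      exact min_le_right _ _
    · filter_upwards [hlim] with x hx
      have h1 : Tendsto (fun i => |(F i x - f x) * h x|) l (nhds 0) := by
        simpa using ((hx.sub_const (f x)).mul_const (h x)).abs
      have h2 := h1.min (tendsto_const_nhds (x := C * h x ^ 2))
      rwa [min_eq_left (by positivity)] at h2
  simpa using key

/-- Pointwise almost everywhere convergence together with convergence of the `L²` norms implies
convergence in `L²`. -/
lemma tendsto_integral_sub_sq (hF : ∀ᶠ i in l, MemLp (F i) 2 μ) (hf : MemLp f 2 μ)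
    (hlim : ∀ᵐ x ∂μ, Tendsto (fun i => F i x) l (nhds (f x)))
    (hint : Tendsto (fun i => ∫ x, F i x ^ 2 ∂μ) l (nhds (∫ x, f x ^ 2 ∂μ))) :
    Tendsto (fun i => ∫ x, (F i x - f x) ^ 2 ∂μ) l (nhds 0) := by
  have hmin := tendsto_integral_min_abs_sub_mul (hF.mono fun i hi => hi.1) hf.1 hf
    (C := 4) (by norm_num) hlim
  have hub : Tendsto (fun i => 2 * ((∫ x, F i x ^ 2 ∂μ) - ∫ x, f x ^ 2 ∂μ) +
      4 * ∫ x, min |(F i x - f x) * f x| (4 * f x ^ 2) ∂μ) l (nhds 0) := by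
    have := ((hint.sub_const (∫ x, f x ^ 2 ∂μ)).const_mul 2).add (hmin.const_mul 4)
    rwa [sub_self, mul_zero, mul_zero, add_zero] at this
  refine tendsto_of_tendsto_of_tendsto_of_le_of_le' tendsto_const_nhds hub
    (Eventually.of_forall fun i => integral_nonneg fun x => sq_nonneg _) ?_
  filter_upwards [hF] with i hi
  have hm : Integrable (fun x => min |(F i x - f x) * f x| (4 * f x ^ 2)) μ :=
    ((hi.sub hf).integrable_mul hf).abs.inf (hf.integrable_sq.const_mul 4)
  have hd : Integrable (fun x => F i x ^ 2 - f x ^ 2) μ := hi.integrable_sq.sub hf.integrable_sq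
  rw [← integral_sub hi.integrable_sq hf.integrable_sq, ← integral_const_mul,
    ← integral_const_mul, ← integral_add (hd.const_mul 2) (hm.const_mul 4)]
  refine integral_mono (hi.sub hf).integrable_sq ((hd.const_mul 2).add (hm.const_mul 4)) ?_
  intro x
  dsimp only
  rcases le_total |(F i x - f x) * f x| (4 * f x ^ 2) with hx | hx
  · rw [min_eq_left hx]
    nlinarith [neg_abs_le ((F i x - f x) * f x), sq_nonneg (F i x - f x)]
  · rw [min_eq_right hx]
    have hfx : 4 * |f x| ^ 2 ≤ |F i x - f x| * |f x| := by rwa [← abs_mul, sq_abs]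
    have h2 : |F i x - f x| * |f x| * 4 ≤ (F i x - f x) ^ 2 := by
      rcases (abs_nonneg (f x)).eq_or_lt with h0 | h0
      · rw [← h0]; simpa using sq_nonneg _
      · have : 4 * |f x| ≤ |F i x - f x| := by
          by_contra! hc
          nlinarith
        rw [← sq_abs (F i x - f x)]
        nlinarith [abs_nonneg (F i x - f x)]
    rw [← abs_mul] at h2
    nlinarith [neg_abs_le ((F i x - f x) * f x), sq_nonneg (f x)]

/-- Pointwise almost everywhere convergence together with convergence of the `L²` norms implies
convergence of the `L²` pairings with a fixed function. -/
lemma tendsto_integral_mul_of_tendsto_integral_sq (hF : ∀ᶠ i in l, MemLp (F i) 2 μ)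
    (hf : MemLp f 2 μ) (hh : MemLp h 2 μ)
    (hlim : ∀ᵐ x ∂μ, Tendsto (fun i => F i x) l (nhds (f x)))
    (hint : Tendsto (fun i => ∫ x, F i x ^ 2 ∂μ) l (nhds (∫ x, f x ^ 2 ∂μ))) :
    Tendsto (fun i => ∫ x, F i x * h x ∂μ) l (nhds (∫ x, f x * h x ∂μ)) := by
  have hmin := tendsto_integral_min_abs_sub_mul (hF.mono fun i hi => hi.1) hf.1 hh
    (C := 1) (by norm_num) hlim
  have hub := hmin.add (tendsto_integral_sub_sq hF hf hlim hint)
  rw [add_zero] at hub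
  rw [tendsto_iff_norm_sub_tendsto_zero]
  refine tendsto_of_tendsto_of_tendsto_of_le_of_le' tendsto_const_nhds hub
    (Eventually.of_forall fun i => norm_nonneg _) ?_
  filter_upwards [hF] with i hi
  have hm : Integrable (fun x => min |(F i x - f x) * h x| (1 * h x ^ 2)) μ :=
    ((hi.sub hf).integrable_mul hh).abs.inf (hh.integrable_sq.const_mul 1)
  have hs : Integrable (fun x => (F i x - f x) ^ 2) μ := (hi.sub hf).integrable_sq
  have hFh : Integrable (fun x => F i x * h x) μ := hi.integrable_mul hh
  have hfh : Integrable (fun x => f x * h x) μ := hf.integrable_mul hh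
  rw [← integral_sub hFh hfh, ← integral_add hm hs]
  refine norm_integral_le_of_norm_le (hm.add hs) (Eventually.of_forall fun x => ?_)
  rw [← sub_mul, Real.norm_eq_abs]
  rcases le_total |(F i x - f x) * h x| (1 * h x ^ 2) with hx | hx
  · rw [min_eq_left hx]
    nlinarith [sq_nonneg (F i x - f x)]
  · rw [min_eq_right hx]
    rw [abs_mul, ← sq_abs (h x)] at *
    rw [← sq_abs (F i x - f x)]
    nlinarith [abs_nonneg (F i x - f x), abs_nonneg (h x), sq_nonneg (|F i x - f x| - |h x|)]

end L2Convergence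

section ExpDecay

/-- A real function is of exponential decay if it is `O(exp (-c r))` at infinity for some
`c > 0`. -/
def ExpDecay (f : ℝ → ℝ) : Prop :=
  ∃ c > (0 : ℝ), f =O[atTop] fun r => Real.exp (-c * r)

lemma exp_neg_mul_isBigO {c d : ℝ} (h : d ≤ c) :
    (fun r : ℝ => Real.exp (-c * r)) =O[atTop] fun r => Real.exp (-d * r) := by
  refine Asymptotics.IsBigO.of_bound 1 ?_
  filter_upwards [eventually_ge_atTop 0] with r hr
  rw [one_mul, Real.norm_of_nonneg (Real.exp_pos _).le, Real.norm_of_nonneg (Real.exp_pos _).le]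
  exact Real.exp_le_exp.2 (by nlinarith)

namespace ExpDecay

variable {f g : ℝ → ℝ}

lemma add (hf : ExpDecay f) (hg : ExpDecay g) : ExpDecay fun r => f r + g r := by
  obtain ⟨c, hc, hf⟩ := hf
  obtain ⟨d, hd, hg⟩ := hg
  exact ⟨min c d, lt_min hc hd, (hf.trans (exp_neg_mul_isBigO (min_le_left _ _))).add
    (hg.trans (exp_neg_mul_isBigO (min_le_right _ _)))⟩

lemma mul (hf : ExpDecay f) (hg : ExpDecay g) : ExpDecay fun r => f r * g r := by
  obtain ⟨c, hc, hf⟩ := hf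
  obtain ⟨d, hd, hg⟩ := hg
  refine ⟨c + d, add_pos hc hd, (hf.mul hg).congr_right fun r => ?_⟩
  rw [← Real.exp_add]
  ring_nf

lemma const_mul (a : ℝ) (hf : ExpDecay f) : ExpDecay fun r => a * f r := by
  obtain ⟨c, hc, hf⟩ := hf
  exact ⟨c, hc, hf.const_mul_left a⟩

lemma pow_mul (k : ℕ) (hf : ExpDecay f) : ExpDecay fun r => r ^ k * f r := by
  obtain ⟨c, hc, hf⟩ := hf
  refine ⟨c / 2, half_pos hc,
    ((isLittleO_pow_exp_pos_mul_atTop k (half_pos hc)).isBigO.mul hf).congr_right fun r => ?_⟩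
  rw [← Real.exp_add]
  ring_nf

lemma tendsto_zero (hf : ExpDecay f) : Tendsto f atTop (nhds 0) := by
  obtain ⟨c, hc, hf⟩ := hf
  refine hf.trans_tendsto (Real.tendsto_exp_atBot.comp ?_)
  exact tendsto_id.const_mul_atTop_of_neg (neg_lt_zero.2 hc)

lemma integrableOn_Ioi {a : ℝ} (hf : ExpDecay f) (hc : ContinuousOn f (Ici a)) :
    IntegrableOn f (Ioi a) := by
  obtain ⟨c, hc0, hf⟩ := hf
  exact integrable_of_isBigO_exp_neg hc0 hc hf

lemma of_abs_le {C c : ℝ} (hc : 0 < c) (hf : ∀ r ≥ (1 : ℝ), |f r| ≤ C * Real.exp (-c * r)) :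
    ExpDecay f := by
  refine ⟨c, hc, Asymptotics.IsBigO.of_bound C ?_⟩
  filter_upwards [eventually_ge_atTop 1] with r hr
  rw [Real.norm_of_nonneg (Real.exp_pos _).le]
  exact hf r hr

end ExpDecay

end ExpDecay

section RadialSolution

/-- `u` solves `-u'' - u' / r + (r - τ) ^ 2 u = ν u` on `(0, ∞)`, is `C¹` up to `0` with
`u' 0 = 0`, and decays exponentially at infinity together with its derivative. -/
structure IsRadialSolution (τ ν : ℝ) (u : ℝ → ℝ) : Prop where
  continuousOn : ContinuousOn u (Ici 0)
  continuousOn_deriv : ContinuousOn (deriv u) (Ici 0)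
  hasDerivAt : ∀ r ∈ Ioi (0 : ℝ), HasDerivAt u (deriv u r) r
  hasDerivAt_deriv : ∀ r ∈ Ioi (0 : ℝ),
    HasDerivAt (deriv u) (((r - τ) ^ 2 - ν) * u r - deriv u r / r) r
  deriv_zero : deriv u 0 = 0
  expDecay : ExpDecay u
  expDecay_deriv : ExpDecay (deriv u)

namespace IsRadialSolution

variable {σ τ μ ν : ℝ} {u v : ℝ → ℝ}

lemma integrableOn_mul_mul_pow (hu : IsRadialSolution σ μ u) (hv : IsRadialSolution τ ν v)
    (k : ℕ) : IntegrableOn (fun r => u r * v r * r ^ k) (Ioi 0) := by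
  refine ExpDecay.integrableOn_Ioi ?_
    ((hu.continuousOn.mul hv.continuousOn).mul (continuous_pow k).continuousOn)
  simpa only [mul_comm] using (hu.expDecay.mul hv.expDecay).pow_mul k

/-- Green's formula for two radial solutions. -/
lemma integral_wronskian (hu : IsRadialSolution σ μ u) (hv : IsRadialSolution τ ν v) :
    ∫ r in Ioi (0 : ℝ), ((τ ^ 2 - σ ^ 2 + (μ - ν)) * (u r * v r * r ^ 1)
      + 2 * (σ - τ) * (u r * v r * r ^ 2)) = 0 := by
  have hint := ((hu.integrableOn_mul_mul_pow hv 1).const_mul (τ ^ 2 - σ ^ 2 + (μ - ν))).add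
    ((hu.integrableOn_mul_mul_pow hv 2).const_mul (2 * (σ - τ)))
  have hdecay : ExpDecay fun r =>
      r ^ 1 * (u r * deriv v r) + -1 * (r ^ 1 * (deriv u r * v r)) :=
    ((hu.expDecay.mul hv.expDecay_deriv).pow_mul 1).add
      (((hu.expDecay_deriv.mul hv.expDecay).pow_mul 1).const_mul (-1))
  have hcont : ContinuousOn (fun r =>
      r ^ 1 * (u r * deriv v r) + -1 * (r ^ 1 * (deriv u r * v r))) (Ici 0) :=
    ((continuous_pow 1).continuousOn.mul (hu.continuousOn.mul hv.continuousOn_deriv)).add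
      (continuousOn_const.mul ((continuous_pow 1).continuousOn.mul
        (hu.continuousOn_deriv.mul hv.continuousOn)))
  refine (integral_Ioi_of_hasDerivAt_of_tendsto (hcont 0 self_mem_Ici) (fun r hr => ?_) hint
    hdecay.tendsto_zero).trans (by simp)
  have hr0 : r ≠ 0 := (mem_Ioi.1 hr).ne'
  have h1 := ((hasDerivAt_pow 1 r).mul ((hu.hasDerivAt r hr).mul (hv.hasDerivAt_deriv r hr))).add
    (((hasDerivAt_pow 1 r).mul ((hu.hasDerivAt_deriv r hr).mul (hv.hasDerivAt r hr))).const_mul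
      (-1))
  refine h1.congr_deriv ?_
  simp only [Pi.mul_apply, Pi.add_apply]
  field_simp
  ring

/-- The derivative of a radial solution vanishes at least linearly at the origin. -/
lemma exists_abs_deriv_le (hu : IsRadialSolution τ ν u) :
    ∃ M, ∀ r ∈ Ioc (0 : ℝ) 1, |deriv u r| ≤ M * r := by
  have hc : ContinuousOn (fun r => ((r - τ) ^ 2 - ν) * u r) (Icc 0 1) :=
    (by fun_prop : Continuous fun r : ℝ => (r - τ) ^ 2 - ν).continuousOn.mul
      (hu.continuousOn.mono Icc_subset_Ici_self)
  obtain ⟨M, hM⟩ := isCompact_Icc.exists_bound_of_continuousOn hc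
  refine ⟨M, fun r hr => ?_⟩
  obtain ⟨hr0, hr1⟩ := hr
  have hderiv : ∀ s ∈ Ioo 0 r, HasDerivAt (fun s => s * deriv u s)
      (s * (((s - τ) ^ 2 - ν) * u s)) s := by
    intro s hs
    have hs0 : s ≠ 0 := hs.1.ne'
    refine ((hasDerivAt_id s).mul (hu.hasDerivAt_deriv s hs.1)).congr_deriv ?_
    simp only [id]
    field_simp
    ring
  obtain ⟨s, hs, hslope⟩ := exists_hasDerivAt_eq_slope (fun s => s * deriv u s) _ hr0
    (continuousOn_id.mul (hu.continuousOn_deriv.mono Icc_subset_Ici_self)) hderiv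
  have hd : deriv u r = s * (((s - τ) ^ 2 - ν) * u s) := by
    rw [hslope]
    field_simp
    simp
  have hMs := hM s ⟨hs.1.le, hs.2.le.trans hr1⟩
  rw [Real.norm_eq_abs] at hMs
  rw [hd, abs_mul, abs_of_pos hs.1, mul_comm M]
  exact mul_le_mul hs.2.le hMs (abs_nonneg _) hr0.le

lemma integrableOn_mul_deriv_div (hu : IsRadialSolution τ ν u) :
    IntegrableOn (fun r => u r * deriv u r / r) (Ioi 0) := by
  have hcont : ContinuousOn (fun r => u r * deriv u r / r) (Ioi 0) :=
    ((hu.continuousOn.mul hu.continuousOn_deriv).mono Ioi_subset_Ici_self).div continuousOn_id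
      fun r hr => (mem_Ioi.1 hr).ne'
  rw [← Ioc_union_Ioi_eq_Ioi (zero_le_one (α := ℝ))]
  refine IntegrableOn.union ?_ ?_
  · obtain ⟨M, hM⟩ := hu.exists_abs_deriv_le
    obtain ⟨K, hK⟩ := isCompact_Icc.exists_bound_of_continuousOn
      (hu.continuousOn.mono (Icc_subset_Ici_self : Icc (0 : ℝ) 1 ⊆ Ici 0))
    refine IntegrableOn.of_bound (C := K * M) (by simp)
      ((hcont.mono Ioc_subset_Ioi_self).aestronglyMeasurable measurableSet_Ioc) ?_
    refine (ae_restrict_iff' measurableSet_Ioc).2 (Eventually.of_forall fun r hr => ?_)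
    have h1 := hM r hr
    have h2 := hK r ⟨hr.1.le, hr.2⟩
    rw [Real.norm_eq_abs] at h2 ⊢
    rw [abs_div, abs_mul, abs_of_pos hr.1, div_le_iff₀ hr.1, mul_assoc]
    exact mul_le_mul h2 h1 (abs_nonneg _) ((abs_nonneg _).trans h2)
  · refine ExpDecay.integrableOn_Ioi ?_
      (hcont.mono fun r hr => mem_Ioi.2 (zero_lt_one.trans_le (mem_Ici.1 hr)))
    obtain ⟨c, hc, h⟩ := hu.expDecay.mul hu.expDecay_deriv
    refine ⟨c, hc, (Asymptotics.IsBigO.of_bound 1 ?_).trans h⟩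
    filter_upwards [eventually_ge_atTop 1] with r hr
    rw [norm_div, one_mul]
    exact div_le_self (norm_nonneg _) (hr.trans (le_abs_self r))

/-- Virial identity for a radial solution. -/
lemma integral_mul_deriv_div (hu : IsRadialSolution τ ν u) :
    ∫ r in Ioi (0 : ℝ), u r * deriv u r / r =
      2 * τ * (∫ r in Ioi (0 : ℝ), u r * u r * r ^ 1)
        - 2 * ∫ r in Ioi (0 : ℝ), u r * u r * r ^ 2 := by
  have h1 := hu.integrableOn_mul_mul_pow hu 1
  have h2 := hu.integrableOn_mul_mul_pow hu 2
  have h12 : IntegrableOn (fun r => 2 * τ * (u r * u r * r ^ 1) - 2 * (u r * u r * r ^ 2))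
    (Ioi 0) := (h1.const_mul (2 * τ)).sub (h2.const_mul 2)
  have hint := hu.integrableOn_mul_deriv_div.sub h12
  have huu := hu.expDecay.mul hu.expDecay
  have hdecay : ExpDecay fun r =>
      r ^ 3 * (u r * u r) + -(2 * τ) * (r ^ 2 * (u r * u r))
        + (τ ^ 2 - ν) * (r ^ 1 * (u r * u r))
        + -1 * (r ^ 1 * (deriv u r * deriv u r)) + -1 * (u r * deriv u r) :=
    ((((huu.pow_mul 3).add ((huu.pow_mul 2).const_mul _)).add ((huu.pow_mul 1).const_mul _)).add
      (((hu.expDecay_deriv.mul hu.expDecay_deriv).pow_mul 1).const_mul _)).add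
      ((hu.expDecay.mul hu.expDecay_deriv).const_mul _)
  have hcu := hu.continuousOn
  have hcd := hu.continuousOn_deriv
  have hcont : ContinuousOn (fun r =>
      r ^ 3 * (u r * u r) + -(2 * τ) * (r ^ 2 * (u r * u r))
        + (τ ^ 2 - ν) * (r ^ 1 * (u r * u r))
        + -1 * (r ^ 1 * (deriv u r * deriv u r)) + -1 * (u r * deriv u r)) (Ici 0) := by
    fun_prop
  have key := integral_Ioi_of_hasDerivAt_of_tendsto (hcont 0 self_mem_Ici) (fun r hr => ?_) hint
    hdecay.tendsto_zero
  · simp only [Pi.sub_apply] at key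
    rw [integral_sub hu.integrableOn_mul_deriv_div h12,
      integral_sub (h1.const_mul (2 * τ)) (h2.const_mul 2), integral_const_mul,
      integral_const_mul] at key
    simp only [hu.deriv_zero] at key
    linarith
  · have hr0 : r ≠ 0 := (mem_Ioi.1 hr).ne'
    have du := hu.hasDerivAt r hr
    have dd := hu.hasDerivAt_deriv r hr
    have duu := du.mul du
    have h := ((((hasDerivAt_pow 3 r).mul duu).add
      (((hasDerivAt_pow 2 r).mul duu).const_mul (-(2 * τ)))).add
      (((hasDerivAt_pow 1 r).mul duu).const_mul (τ ^ 2 - ν))).add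
      (((hasDerivAt_pow 1 r).mul (dd.mul dd)).const_mul (-1)) |>.add ((du.mul dd).const_mul (-1))
    refine h.congr_deriv ?_
    simp only [Pi.mul_apply, Pi.sub_apply]
    field_simp
    ring

lemma of_ode (h2 : ContDiffOn ℝ 2 u (Ioi 0))
    (hode : ∀ r ∈ Ioi (0 : ℝ),
      -(deriv (deriv u) r) - (1 / r) * deriv u r + (r - τ) ^ 2 * u r = ν * u r)
    (hu : ContinuousOn u (Ici 0)) (hu' : ContinuousOn (deriv u) (Ici 0))
    (hneu : Tendsto (deriv u) (nhdsWithin 0 (Ioi 0)) (nhds 0)) {C c : ℝ} (hc : 0 < c)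
    (hdecay : ∀ r ≥ (1 : ℝ), |u r| + |deriv u r| ≤ C * Real.exp (-c * r)) :
    IsRadialSolution τ ν u where
  continuousOn := hu
  continuousOn_deriv := hu'
  hasDerivAt r hr :=
    ((h2.differentiableOn two_ne_zero).differentiableAt (isOpen_Ioi.mem_nhds hr)).hasDerivAt
  hasDerivAt_deriv r hr := by
    have h1 : ContDiffOn ℝ 1 (deriv u) (Ioi 0) := h2.deriv_of_isOpen isOpen_Ioi (by norm_num)
    refine ((h1.differentiableOn one_ne_zero).differentiableAt
      (isOpen_Ioi.mem_nhds hr)).hasDerivAt.congr_deriv ?_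
    linear_combination -hode r hr
  deriv_zero := tendsto_nhds_unique
    ((hu' 0 self_mem_Ici).tendsto.mono_left (nhdsWithin_mono 0 Ioi_subset_Ici_self)) hneu
  expDecay := .of_abs_le hc fun r hr =>
    (le_add_of_nonneg_right (abs_nonneg _)).trans (hdecay r hr)
  expDecay_deriv := .of_abs_le hc fun r hr =>
    (le_add_of_nonneg_left (abs_nonneg _)).trans (hdecay r hr)

lemma memLp_pow_mul_sqrt (hu : IsRadialSolution τ ν u) (k : ℕ) :
    MemLp (fun r => u r * r ^ k * √r) 2 (volume.restrict (Ioi 0)) := by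
  have hc : ContinuousOn (fun r => u r * r ^ k * √r) (Ioi 0) :=
    ((hu.continuousOn.mono Ioi_subset_Ici_self).mul (continuous_pow k).continuousOn).mul
      Real.continuous_sqrt.continuousOn
  refine (memLp_two_iff_integrable_sq (hc.aestronglyMeasurable measurableSet_Ioi)).2 ?_
  refine (hu.integrableOn_mul_mul_pow hu (2 * k + 1)).congr_fun (fun r hr => ?_)
    measurableSet_Ioi
  dsimp only
  rw [mul_pow, Real.sq_sqrt (mem_Ioi.1 hr).le]
  ring

/-- A family of radial solutions converging pointwise, with convergence of the norms in
`L²(r dr)`, has convergent weighted pairings with its limit. -/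
lemma tendsto_integral_mul_mul_pow {ι : Type*} {l : Filter ι} [l.IsCountablyGenerated]
    {s n : ι → ℝ} {w : ι → ℝ → ℝ} (hw : ∀ᶠ i in l, IsRadialSolution (s i) (n i) (w i))
    (hu : IsRadialSolution τ ν u)
    (hlim : ∀ r ∈ Ioi (0 : ℝ), Tendsto (fun i => w i r) l (nhds (u r)))
    (hnorm : Tendsto (fun i => ∫ r in Ioi (0 : ℝ), w i r * w i r * r ^ 1) l
      (nhds (∫ r in Ioi (0 : ℝ), u r * u r * r ^ 1))) (k : ℕ) :
    Tendsto (fun i => ∫ r in Ioi (0 : ℝ), w i r * u r * r ^ (k + 1)) l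
      (nhds (∫ r in Ioi (0 : ℝ), u r * u r * r ^ (k + 1))) := by
  have hprod : ∀ (f g : ℝ → ℝ) (m : ℕ), ∫ r in Ioi (0 : ℝ), f r * g r * r ^ (m + 1) =
      ∫ r in Ioi (0 : ℝ), (f r * r ^ 0 * √r) * (g r * r ^ m * √r) := fun f g m =>
    setIntegral_congr_fun measurableSet_Ioi fun r hr => by
      linear_combination -(f r * g r * r ^ m) * Real.mul_self_sqrt (mem_Ioi.1 hr).le
  simp only [hprod]
  refine tendsto_integral_mul_of_tendsto_integral_sq (hw.mono fun i hi => hi.memLp_pow_mul_sqrt 0)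
    (hu.memLp_pow_mul_sqrt 0) (hu.memLp_pow_mul_sqrt k) ?_ ?_
  · exact (ae_restrict_iff' measurableSet_Ioi).2 (Eventually.of_forall fun r hr =>
      ((hlim r hr).mul_const _).mul_const _)
  · simpa only [sq, ← hprod _ _ 0] using hnorm

end IsRadialSolution

end RadialSolution

/-- Derivative of a band function of the singular operator `𝔤(τ) = −∂_r² − (1/r)∂_r + (r−τ)²`:
if `z(τ,·)` is a family of normalized eigenfunctions (in `L²_r(ℝ₊)`) associated to `ζ(τ)`,
depending smoothly on `τ ∈ (a,b)`, extending continuously to `[0,∞)` with Neumann condition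
`∂_r z(τ,0) = 0` and with locally uniform exponential decay, then
`ζ'(τ) = ⟨(𝔥₀^N(τ) − ζ(τ)) z(τ,·), z(τ,·)⟩` in the *unweighted* space `L²(ℝ₊)`, i.e.
`ζ'(τ) = ∫₀^∞ (−∂_r² z(τ,r) + ((r−τ)² − ζ(τ)) z(τ,r)) z(τ,r) dr`. -/
theorem band_function_derivative_formula (a b : ℝ) (ζ : ℝ → ℝ) (z zt : ℝ → ℝ → ℝ)
    (hzr : ∀ τ ∈ Ioo a b, ContDiffOn ℝ 2 (z τ) (Ioi 0))
    (hzt : ∀ τ ∈ Ioo a b, ∀ r ∈ Ioi (0:ℝ), HasDerivAt (fun σ => z σ r) (zt τ r) τ)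
    (hztc : ∀ r ∈ Ioi (0:ℝ), ContinuousOn (fun τ => zt τ r) (Ioo a b))
    (hode : ∀ τ ∈ Ioo a b, ∀ r ∈ Ioi (0:ℝ),
      -(deriv (deriv (z τ)) r) - (1 / r) * deriv (z τ) r + (r - τ) ^ 2 * z τ r
        = ζ τ * z τ r)
    (hnorm : ∀ τ ∈ Ioo a b, ∫ r in Ioi (0:ℝ), (z τ r) ^ 2 * r = 1)
    (hcont : ∀ τ ∈ Ioo a b, ContinuousOn (z τ) (Ici 0) ∧ ContinuousOn (deriv (z τ)) (Ici 0))
    (hneu : ∀ τ ∈ Ioo a b, Tendsto (deriv (z τ)) (nhdsWithin 0 (Ioi 0)) (nhds 0))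
    (hdecay : ∀ τ ∈ Ioo a b, ∃ ε > (0:ℝ), ∃ C > (0:ℝ), ∃ c > (0:ℝ),
      ∀ σ ∈ Ioo a b, |σ - τ| < ε → ∀ r ≥ (1:ℝ),
        |z σ r| + |deriv (z σ) r| + |zt σ r| ≤ C * Real.exp (-c * r)) :
    ∀ τ ∈ Ioo a b, HasDerivAt ζ
      (∫ r in Ioi (0:ℝ),
        (-(deriv (deriv (z τ)) r) + ((r - τ) ^ 2 - ζ τ) * z τ r) * z τ r) τ := by
  intro τ hτ
  have hsol : ∀ σ ∈ Ioo a b, IsRadialSolution σ (ζ σ) (z σ) := fun σ hσ => by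
    obtain ⟨ε, hε, C, -, c, hc, hb⟩ := hdecay σ hσ
    exact IsRadialSolution.of_ode (hzr σ hσ) (hode σ hσ) (hcont σ hσ).1 (hcont σ hσ).2
      (hneu σ hσ) hc fun r hr =>
        (le_add_of_nonneg_right (abs_nonneg _)).trans (hb σ hσ (by simpa using hε) r hr)
  have hτs := hsol τ hτ
  have hnear : ∀ᶠ σ in nhdsWithin τ {τ}ᶜ, σ ∈ Ioo a b :=
    nhdsWithin_le_nhds (isOpen_Ioo.mem_nhds hτ)
  have hpoint : ∀ r ∈ Ioi (0 : ℝ),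
      Tendsto (fun σ => z σ r) (nhdsWithin τ {τ}ᶜ) (nhds (z τ r)) := fun r hr =>
    (hzt τ hτ r hr).continuousAt.tendsto.mono_left nhdsWithin_le_nhds
  have hnorm' : ∀ σ ∈ Ioo a b, ∫ r in Ioi (0 : ℝ), z σ r * z σ r * r ^ 1 = 1 := fun σ hσ => by
    simpa only [sq, pow_one] using hnorm σ hσ
  have hpair : ∀ k : ℕ, Tendsto (fun σ => ∫ r in Ioi (0 : ℝ), z σ r * z τ r * r ^ (k + 1))
      (nhdsWithin τ {τ}ᶜ) (nhds (∫ r in Ioi (0 : ℝ), z τ r * z τ r * r ^ (k + 1))) :=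
    IsRadialSolution.tendsto_integral_mul_mul_pow (hnear.mono hsol) hτs hpoint <| by
      rw [hnorm' τ hτ]
      exact tendsto_const_nhds.congr' (hnear.mono fun σ hσ => (hnorm' σ hσ).symm)
  have hA := hpair 0
  have hB := hpair 1
  rw [zero_add, hnorm' τ hτ] at hA
  rw [one_add_one_eq_two] at hB
  have hrhs : ∫ r in Ioi (0 : ℝ),
        (-(deriv (deriv (z τ)) r) + ((r - τ) ^ 2 - ζ τ) * z τ r) * z τ r
      = 2 * τ * 1 - 2 * ∫ r in Ioi (0 : ℝ), z τ r * z τ r * r ^ 2 := by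
    rw [← hnorm' τ hτ, ← hτs.integral_mul_deriv_div]
    refine setIntegral_congr_fun measurableSet_Ioi fun r hr => ?_
    rw [(hτs.hasDerivAt_deriv r hr).deriv]
    ring
  rw [hrhs, hasDerivAt_iff_tendsto_slope]
  have hid : Tendsto (fun σ : ℝ => σ) (nhdsWithin τ {τ}ᶜ) (nhds τ) := nhdsWithin_le_nhds
  have hlim := ((hid.add_const τ).sub ((hB.const_mul 2).div hA one_ne_zero))
  have hval : τ + τ - 2 * (∫ r in Ioi (0 : ℝ), z τ r * z τ r * r ^ 2) / 1
      = 2 * τ * 1 - 2 * ∫ r in Ioi (0 : ℝ), z τ r * z τ r * r ^ 2 := by ring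
  rw [hval] at hlim
  refine hlim.congr' ?_
  filter_upwards [hnear, hA.eventually_ne one_ne_zero, self_mem_nhdsWithin] with σ hσ hAσ hne
  have hw := (hsol σ hσ).integral_wronskian hτs
  rw [integral_add (((hsol σ hσ).integrableOn_mul_mul_pow hτs 1).const_mul _)
    (((hsol σ hσ).integrableOn_mul_mul_pow hτs 2).const_mul _), integral_const_mul,
    integral_const_mul] at hw
  have hne' : σ - τ ≠ 0 := sub_ne_zero.2 hne
  rw [slope_def_field]
  simp only [Pi.div_apply]
  generalize (∫ r in Ioi (0 : ℝ), z σ r * z τ r * r ^ 1) = A at *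
  generalize (∫ r in Ioi (0 : ℝ), z σ r * z τ r * r ^ 2) = B at *
  field_simp
  linear_combination -hw
end

section
/- Let τ ∈ ℝ, ζ ∈ ℝ, and let z : (0,∞) → ℝ be twice continuously differentiable, solving −z''(r) − (1/r) z'(r) + (r−τ)² z(r) = ζ z(r) for all r > 0, such that z and z' extend continuously to [0,∞) with z'(0) = 0 and there exist C, c > 0 with |z(r)| + |z'(r)| ≤ C e^{−c r} for r ≥ 1. Then the virial identity ∫₀^∞ |z'(r)|² r dr = ∫₀^∞ r (r−τ) |z(r)|² r dr holds. -/
open MeasureTheory Set Filter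

/-- A polynomial times two functions of order `exp (-c r)` is again of order `exp (-c r)`. -/
lemma isBigO_polynomial_mul_mul_exp_neg {c : ℝ} (hc : 0 < c) (p : Polynomial ℝ) {f g : ℝ → ℝ}
    (hf : f =O[atTop] fun r => Real.exp (-c * r)) (hg : g =O[atTop] fun r => Real.exp (-c * r)) :
    (fun r => p.eval r * f r * g r) =O[atTop] fun r => Real.exp (-c * r) := by
  have hp : (fun r => p.eval r) =O[atTop] fun r => Real.exp (c * r) := by
    simp_rw [Polynomial.eval_eq_sum_range]
    exact Asymptotics.IsBigO.fun_sum fun i _ =>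
      ((isLittleO_pow_exp_pos_mul_atTop i hc).isBigO).const_mul_left _
  refine ((hp.mul hf).mul hg).congr_right fun r => ?_
  rw [← Real.exp_add, ← Real.exp_add]
  ring_nf

/-- The function `r z z' + (r² z'² - r² V z²) / 2`, with `V = (r - τ)² - ζ`, is a primitive of
the difference of the two densities in the virial identity. -/
lemma hasDerivAt_virial_primitive {τ ζ r w : ℝ} {z u : ℝ → ℝ} (hr : r ≠ 0)
    (hz : HasDerivAt z (u r) r) (hu : HasDerivAt u w r)
    (hode : -w - (1 / r) * u r + (r - τ) ^ 2 * z r = ζ * z r) :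
    HasDerivAt
      (fun x => x * z x * u x + (x ^ 2 * u x * u x - x ^ 2 * ((x - τ) ^ 2 - ζ) * z x * z x) / 2)
      (u r ^ 2 * r - r * (r - τ) * z r ^ 2 * r) r := by
  have hid := hasDerivAt_id' r
  have hw : w = -(1 / r) * u r + ((r - τ) ^ 2 - ζ) * z r := by linarith
  have hsq := hid.pow 2
  have hV := ((hid.sub_const τ).pow 2).sub_const ζ
  refine HasDerivAt.congr_deriv (((hid.mul hz).mul hu).add
    ((((hsq.mul hu).mul hu).sub (((hsq.mul hV).mul hz).mul hz)).div_const 2)) ?_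
  simp only [Pi.mul_apply, Pi.pow_apply, hw]
  field_simp
  ring

/-- Virial identity: if `z` solves `−z'' − (1/r) z' + (r−τ)² z = ζ z` on `(0,∞)`, extends
continuously to `[0,∞)` together with `z'`, satisfies the Neumann condition `z'(0) = 0` (as a
limit from the right) and has exponential decay, then
`∫₀^∞ |z'(r)|² r dr = ∫₀^∞ r (r−τ) |z(r)|² r dr`. -/
theorem virial_identity (τ ζ : ℝ) (z : ℝ → ℝ)
    (hz : ContDiffOn ℝ 2 z (Ioi 0))
    (hode : ∀ r ∈ Ioi (0:ℝ),
      -(deriv (deriv z) r) - (1 / r) * deriv z r + (r - τ) ^ 2 * z r = ζ * z r)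
    (hcont : ContinuousOn z (Ici 0)) (hcont' : ContinuousOn (deriv z) (Ici 0))
    (hneu : Tendsto (deriv z) (nhdsWithin 0 (Ioi 0)) (nhds 0))
    (C c : ℝ) (hC : 0 < C) (hc : 0 < c)
    (hdecay : ∀ r ≥ (1:ℝ), |z r| + |deriv z r| ≤ C * Real.exp (-c * r)) :
    ∫ r in Ioi (0:ℝ), (deriv z r) ^ 2 * r
      = ∫ r in Ioi (0:ℝ), (r * (r - τ) * (z r) ^ 2) * r := by
  have hOz : z =O[atTop] fun r => Real.exp (-c * r) := by
    refine Asymptotics.IsBigO.of_bound C ?_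
    filter_upwards [eventually_ge_atTop 1] with r hr
    rw [Real.norm_eq_abs, Real.norm_of_nonneg (Real.exp_nonneg _)]
    linarith [hdecay r hr, abs_nonneg (deriv z r)]
  have hOu : deriv z =O[atTop] fun r => Real.exp (-c * r) := by
    refine Asymptotics.IsBigO.of_bound C ?_
    filter_upwards [eventually_ge_atTop 1] with r hr
    rw [Real.norm_eq_abs, Real.norm_of_nonneg (Real.exp_nonneg _)]
    linarith [hdecay r hr, abs_nonneg (z r)]
  have hexp : Tendsto (fun r : ℝ => Real.exp (-c * r)) atTop (nhds 0) :=
    Real.tendsto_exp_atBot.comp (tendsto_id.const_mul_atTop_of_neg (neg_lt_zero.2 hc))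
  have hint₁ : IntegrableOn (fun r => deriv z r ^ 2 * r) (Ioi 0) := by
    refine integrable_of_isBigO_exp_neg hc (by fun_prop) ?_
    refine (isBigO_polynomial_mul_mul_exp_neg hc Polynomial.X hOu hOu).congr_left fun r => ?_
    simp only [Polynomial.eval_X]
    ring
  have hint₂ : IntegrableOn (fun r => r * (r - τ) * z r ^ 2 * r) (Ioi 0) := by
    refine integrable_of_isBigO_exp_neg hc (by fun_prop) ?_
    refine (isBigO_polynomial_mul_mul_exp_neg hc
      (Polynomial.X ^ 2 * (Polynomial.X - Polynomial.C τ)) hOz hOz).congr_left fun r => ?_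
    simp only [Polynomial.eval_mul, Polynomial.eval_pow, Polynomial.eval_sub, Polynomial.eval_X,
      Polynomial.eval_C]
    ring
  have hlim : Tendsto (fun x => x * z x * deriv z x
      + (x ^ 2 * deriv z x * deriv z x - x ^ 2 * ((x - τ) ^ 2 - ζ) * z x * z x) / 2)
      atTop (nhds 0) := by
    have h₁ := (isBigO_polynomial_mul_mul_exp_neg hc Polynomial.X hOz hOu).trans_tendsto hexp
    have h₂ := (isBigO_polynomial_mul_mul_exp_neg hc
      (Polynomial.X ^ 2) hOu hOu).trans_tendsto hexp
    have h₃ := (isBigO_polynomial_mul_mul_exp_neg hc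
      (Polynomial.X ^ 2 * ((Polynomial.X - Polynomial.C τ) ^ 2 - Polynomial.C ζ))
      hOz hOz).trans_tendsto hexp
    simpa using h₁.add ((h₂.sub h₃).div_const 2)
  have hderiv : ∀ r ∈ Ioi (0:ℝ), HasDerivAt (fun x => x * z x * deriv z x
      + (x ^ 2 * deriv z x * deriv z x - x ^ 2 * ((x - τ) ^ 2 - ζ) * z x * z x) / 2)
      (deriv z r ^ 2 * r - r * (r - τ) * z r ^ 2 * r) r := by
    intro r hr
    have hnhds : Ioi (0:ℝ) ∈ nhds r := isOpen_Ioi.mem_nhds hr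
    have hu : ContDiffOn ℝ 1 (deriv z) (Ioi 0) := hz.deriv_of_isOpen isOpen_Ioi (by norm_num)
    exact hasDerivAt_virial_primitive (ne_of_gt hr)
      ((hz.differentiableOn (by norm_num)).differentiableAt hnhds).hasDerivAt
      ((hu.differentiableOn (by norm_num)).differentiableAt hnhds).hasDerivAt (hode r hr)
  have hzero := integral_Ioi_of_hasDerivAt_of_tendsto
    (ContinuousOn.continuousWithinAt (by fun_prop) self_mem_Ici) hderiv
    (hint₁.sub hint₂) hlim
  rw [integral_sub hint₁ hint₂] at hzero
  exact sub_eq_zero.1 (by simpa using hzero)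
end

section
/- Let τ_C ∈ ℝ, ζ ∈ ℝ, and let z : (0,∞) → ℝ be twice continuously differentiable, solving −z''(r) − (1/r) z'(r) + (r−τ_C)² z(r) = ζ z(r) for all r > 0, with z, z' extending continuously to [0,∞), z'(0) = 0, exponential decay |z(r)| + |z'(r)| ≤ C e^{−c r} for r ≥ 1 (some C, c > 0), normalization ∫₀^∞ z(r)² r dr = 1, and the criticality condition ∫₀^∞ (r−τ_C) z(r)² r dr = 0. Then ∫₀^∞ |z'(r)|² r dr = ∫₀^∞ (r−τ_C)² z(r)² r dr = ζ/2. -/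
open MeasureTheory Set Filter

open Polynomial in
/-- A polynomial times two exponentially decaying functions decays exponentially. -/
lemma polynomial_mul_mul_isBigO_exp_neg {u v : ℝ → ℝ} {c : ℝ} (hc : 0 < c)
    (hu : u =O[atTop] fun r => Real.exp (-c * r)) (hv : v =O[atTop] fun r => Real.exp (-c * r))
    (p : ℝ[X]) :
    (fun r => p.eval r * (u r * v r)) =O[atTop] fun r => Real.exp (-c * r) := by
  have hp : (fun r => p.eval r) =O[atTop] fun r => Real.exp (c * r) := by
    have h : (fun r => p.eval r) =O[atTop] fun r => (X ^ p.natDegree : ℝ[X]).eval r :=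
      Polynomial.isBigO_atTop_of_degree_le _ _ (by simp [p.degree_le_natDegree])
    simp only [eval_pow, eval_X] at h
    exact h.trans (isLittleO_pow_exp_pos_mul_atTop p.natDegree hc).isBigO
  refine (hp.mul (hu.mul hv)).congr_right fun r => ?_
  rw [← Real.exp_add, ← Real.exp_add]
  congr 1
  ring

open Polynomial in
lemma integrableOn_polynomial_mul_mul {u v : ℝ → ℝ} {c : ℝ} (hc : 0 < c)
    (hu : u =O[atTop] fun r => Real.exp (-c * r)) (hv : v =O[atTop] fun r => Real.exp (-c * r))
    (hu' : ContinuousOn u (Ici 0)) (hv' : ContinuousOn v (Ici 0)) (p : ℝ[X]) :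
    IntegrableOn (fun r => p.eval r * (u r * v r)) (Ioi 0) :=
  integrable_of_isBigO_exp_neg hc (p.continuous.continuousOn.mul (hu'.mul hv'))
    (polynomial_mul_mul_isBigO_exp_neg hc hu hv p)

open Polynomial in
lemma tendsto_polynomial_mul_mul_atTop_zero {u v : ℝ → ℝ} {c : ℝ} (hc : 0 < c)
    (hu : u =O[atTop] fun r => Real.exp (-c * r)) (hv : v =O[atTop] fun r => Real.exp (-c * r))
    (p : ℝ[X]) :
    Tendsto (fun r => p.eval r * (u r * v r)) atTop (nhds 0) := by
  refine (polynomial_mul_mul_isBigO_exp_neg hc hu hv p).trans_tendsto ?_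
  refine Real.tendsto_exp_atBot.comp ?_
  exact tendsto_id.const_mul_atTop_of_neg (neg_lt_zero.mpr hc)

/-- Virial identity at a critical point: if `z` is a normalized solution of
`−z'' − (1/r) z' + (r−τ_C)² z = ζ z` on `(0,∞)` (with Neumann condition at `0` and exponential
decay) satisfying the Feynman–Hellmann criticality condition `∫₀^∞ (r−τ_C) z² r dr = 0`, then
`∫₀^∞ |z'(r)|² r dr = ∫₀^∞ (r−τ_C)² z(r)² r dr = ζ/2`. -/
theorem virial_identity_critical_point (τC ζ : ℝ) (z : ℝ → ℝ)
    (hz : ContDiffOn ℝ 2 z (Ioi 0))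
    (hode : ∀ r ∈ Ioi (0:ℝ),
      -(deriv (deriv z) r) - (1 / r) * deriv z r + (r - τC) ^ 2 * z r = ζ * z r)
    (hcont : ContinuousOn z (Ici 0)) (hcont' : ContinuousOn (deriv z) (Ici 0))
    (hneu : Tendsto (deriv z) (nhdsWithin 0 (Ioi 0)) (nhds 0))
    (C c : ℝ) (hC : 0 < C) (hc : 0 < c)
    (hdecay : ∀ r ≥ (1:ℝ), |z r| + |deriv z r| ≤ C * Real.exp (-c * r))
    (hnorm : ∫ r in Ioi (0:ℝ), (z r) ^ 2 * r = 1)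
    (hcrit : ∫ r in Ioi (0:ℝ), ((r - τC) * (z r) ^ 2) * r = 0) :
    ∫ r in Ioi (0:ℝ), (deriv z r) ^ 2 * r
        = ∫ r in Ioi (0:ℝ), ((r - τC) ^ 2 * (z r) ^ 2) * r ∧
    ∫ r in Ioi (0:ℝ), ((r - τC) ^ 2 * (z r) ^ 2) * r = ζ / 2 := by
  have hd : ∀ r ∈ Ioi (0:ℝ), HasDerivAt z (deriv z r) r := fun r hr =>
    ((hz.differentiableOn (by norm_num)).differentiableAt (Ioi_mem_nhds hr)).hasDerivAt
  have hd' : ∀ r ∈ Ioi (0:ℝ), HasDerivAt (deriv z) (deriv (deriv z) r) r := fun r hr =>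
    (((hz.deriv_of_isOpen (m := 1) isOpen_Ioi (by norm_num)).differentiableOn
      (by norm_num)).differentiableAt (Ioi_mem_nhds hr)).hasDerivAt
  have hode' : ∀ r ∈ Ioi (0:ℝ),
      r * deriv (deriv z) r = r * ((r - τC) ^ 2 - ζ) * z r - deriv z r := by
    intro r hr
    have hr0 : r ≠ 0 := (mem_Ioi.mp hr).ne'
    have h := hode r hr
    field_simp at h
    linear_combination -h
  have hzO : z =O[atTop] fun r => Real.exp (-c * r) := by
    refine Asymptotics.IsBigO.of_bound C ?_
    filter_upwards [eventually_ge_atTop 1] with r hr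
    rw [Real.norm_eq_abs, Real.norm_eq_abs, Real.abs_exp]
    linarith [hdecay r hr, abs_nonneg (deriv z r)]
  have hzO' : deriv z =O[atTop] fun r => Real.exp (-c * r) := by
    refine Asymptotics.IsBigO.of_bound C ?_
    filter_upwards [eventually_ge_atTop 1] with r hr
    rw [Real.norm_eq_abs, Real.norm_eq_abs, Real.abs_exp]
    linarith [hdecay r hr, abs_nonneg (z r)]
  have iN : IntegrableOn (fun r => (z r) ^ 2 * r) (Ioi 0) := by
    refine (integrableOn_polynomial_mul_mul hc hzO hzO hcont hcont Polynomial.X).congr_fun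
      (fun r _ => ?_) measurableSet_Ioi
    simp only [Polynomial.eval_X]; ring
  have iK : IntegrableOn (fun r => (deriv z r) ^ 2 * r) (Ioi 0) := by
    refine (integrableOn_polynomial_mul_mul hc hzO' hzO' hcont' hcont' Polynomial.X).congr_fun
      (fun r _ => ?_) measurableSet_Ioi
    simp only [Polynomial.eval_X]; ring
  have iM : IntegrableOn (fun r => ((r - τC) * (z r) ^ 2) * r) (Ioi 0) := by
    refine (integrableOn_polynomial_mul_mul hc hzO hzO hcont hcont ((Polynomial.X - Polynomial.C τC) * Polynomial.X)).congr_fun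
      (fun r _ => ?_) measurableSet_Ioi
    simp only [Polynomial.eval_X, Polynomial.eval_mul, Polynomial.eval_sub, Polynomial.eval_C]; ring
  have iP : IntegrableOn (fun r => ((r - τC) ^ 2 * (z r) ^ 2) * r) (Ioi 0) := by
    refine (integrableOn_polynomial_mul_mul hc hzO hzO hcont hcont
      ((Polynomial.X - Polynomial.C τC) ^ 2 * Polynomial.X)).congr_fun (fun r _ => ?_) measurableSet_Ioi
    simp only [Polynomial.eval_X, Polynomial.eval_mul, Polynomial.eval_sub, Polynomial.eval_C, Polynomial.eval_pow]; ring
  have iKP : IntegrableOn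
      (fun r => (deriv z r) ^ 2 * r + ((r - τC) ^ 2 * (z r) ^ 2) * r) (Ioi 0) := iK.add iP
  have iPM : IntegrableOn (fun r => 4 * (((r - τC) ^ 2 * (z r) ^ 2) * r)
      + 2 * τC * (((r - τC) * (z r) ^ 2) * r)) (Ioi 0) :=
    (iP.const_mul 4).add (iM.const_mul (2 * τC))
  have energy : (∫ r in Ioi (0:ℝ), (deriv z r) ^ 2 * r)
      + (∫ r in Ioi (0:ℝ), ((r - τC) ^ 2 * (z r) ^ 2) * r)
      - ζ * ∫ r in Ioi (0:ℝ), (z r) ^ 2 * r = 0 := by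
    have h := integral_Ioi_of_hasDerivAt_of_tendsto (a := 0)
      (f := fun r => r * (z r * deriv z r))
      (f' := fun r => (deriv z r) ^ 2 * r + ((r - τC) ^ 2 * (z r) ^ 2) * r
        - ζ * ((z r) ^ 2 * r))
      ((continuousOn_id.mul (hcont.mul hcont')) 0 self_mem_Ici)
      (fun r hr => by
        refine ((hasDerivAt_id' r).mul ((hd r hr).mul (hd' r hr))).congr_deriv ?_
        simp only [Pi.mul_apply]
        linear_combination z r * hode' r hr)
      (iKP.sub (iN.const_mul ζ))
      (by simpa using tendsto_polynomial_mul_mul_atTop_zero hc hzO hzO' Polynomial.X)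
    rw [integral_sub iKP (iN.const_mul ζ), integral_add iK iP,
      integral_const_mul] at h
    simpa using h
  have virial : 4 * (∫ r in Ioi (0:ℝ), ((r - τC) ^ 2 * (z r) ^ 2) * r)
      + 2 * τC * (∫ r in Ioi (0:ℝ), ((r - τC) * (z r) ^ 2) * r)
      - 2 * ζ * ∫ r in Ioi (0:ℝ), (z r) ^ 2 * r = 0 := by
    have hW : ∀ r : ℝ, HasDerivAt (fun r : ℝ => r ^ 2 * ((r - τC) ^ 2 - ζ))
        (2 * r * ((r - τC) ^ 2 - ζ) + r ^ 2 * (2 * (r - τC))) r := by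
      intro r
      refine ((hasDerivAt_pow 2 r).mul
        ((((hasDerivAt_id' r).sub_const τC).pow 2).sub_const ζ)).congr_deriv ?_
      simp
    have h := integral_Ioi_of_hasDerivAt_of_tendsto (a := 0) (m := 0)
      (f := fun r => r ^ 2 * ((r - τC) ^ 2 - ζ) * (z r * z r)
        - r ^ 2 * (deriv z r * deriv z r))
      (f' := fun r => 4 * (((r - τC) ^ 2 * (z r) ^ 2) * r)
        + 2 * τC * (((r - τC) * (z r) ^ 2) * r) - 2 * ζ * ((z r) ^ 2 * r))
      (by
        have : ContinuousOn (fun r => r ^ 2 * ((r - τC) ^ 2 - ζ) * (z r * z r)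
            - r ^ 2 * (deriv z r * deriv z r)) (Ici 0) := by fun_prop
        exact this 0 self_mem_Ici)
      (fun r hr => by
        refine (((hW r).mul ((hd r hr).mul (hd r hr))).sub
          ((hasDerivAt_pow 2 r).mul ((hd' r hr).mul (hd' r hr)))).congr_deriv ?_
        simp only [Pi.mul_apply]
        push_cast
        linear_combination (-2 * r * deriv z r) * hode' r hr)
      (iPM.sub (iN.const_mul (2 * ζ)))
      (by
        have hP := tendsto_polynomial_mul_mul_atTop_zero hc hzO hzO
          (Polynomial.X ^ 2 * ((Polynomial.X - Polynomial.C τC) ^ 2 - Polynomial.C ζ))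
        have hK := tendsto_polynomial_mul_mul_atTop_zero hc hzO' hzO' (Polynomial.X ^ 2)
        simp only [Polynomial.eval_mul, Polynomial.eval_pow, Polynomial.eval_sub, Polynomial.eval_X, Polynomial.eval_C] at hP hK
        simpa only [sub_zero] using hP.sub hK)
    rw [integral_sub iPM (iN.const_mul (2 * ζ)),
      integral_add (iP.const_mul 4) (iM.const_mul (2 * τC)), integral_const_mul,
      integral_const_mul, integral_const_mul] at h
    simpa using h
  rw [hnorm] at energy virial
  rw [hcrit] at virial
  constructor <;> linarith
end

section
/- Let I ⊂ ℝ be an open interval, ζ : I → ℝ, and z : I × (0,∞) → ℝ be continuously differentiable in τ and twice continuously differentiable in r, such that for every τ ∈ I: (i) z(τ,·) solves −∂_r² z(τ,r) − (1/r) ∂_r z(τ,r) + (r−τ)² z(τ,r) = ζ(τ) z(τ,r) for all r > 0; (ii) ∫₀^∞ z(τ,r)² r dr = 1; (iii) z(τ,·), ∂_r z(τ,·) extend continuously to [0,∞) with ∂_r z(τ,0) = 0 and there exist C, c > 0 (locally uniform in τ) with |z(τ,r)| + |∂_r z(τ,r)| + |∂_τ z(τ,r)| ≤ C e^{−c r}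 for r ≥ 1. Then ζ is differentiable on I and the Feynman–Hellmann formula ζ'(τ) = −2 ∫₀^∞ (r−τ) z(τ,r)² r dr holds for every τ ∈ I. -/
open MeasureTheory Set Filter

section SquareIntegrable

variable {α ι : Type*} [MeasurableSpace α] {μ : Measure α} {l : Filter ι} {u : ι → α → ℝ}
  {v : α → ℝ}

/-- Almost everywhere convergence together with equality of the `L²` norms implies convergence
in `L²`. -/
theorem tendsto_integral_sub_sq_of_integral_sq_eq [l.IsCountablyGenerated]
    (hu : ∀ᶠ i in l, MemLp (u i) 2 μ) (hv : MemLp v 2 μ)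
    (heq : ∀ᶠ i in l, ∫ x, u i x ^ 2 ∂μ = ∫ x, v x ^ 2 ∂μ)
    (hlim : ∀ᵐ x ∂μ, Tendsto (fun i => u i x) l (nhds (v x))) :
    Tendsto (fun i => ∫ x, (u i x - v x) ^ 2 ∂μ) l (nhds 0) := by
  have hdom : Tendsto (fun i => ∫ x, max 0 (4 * v x ^ 2 - (u i x + v x) ^ 2) ∂μ) l
      (nhds (∫ _, (0 : ℝ) ∂μ)) := by
    refine tendsto_integral_filter_of_dominated_convergence (fun x => 4 * v x ^ 2) ?_ ?_
      (hv.integrable_sq.const_mul 4) ?_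
    · filter_upwards [hu] with i hi
      exact aestronglyMeasurable_const.sup
        (((hv.1.pow 2).const_mul 4).sub ((hi.1.add hv.1).pow 2))
    · refine Eventually.of_forall fun i => Eventually.of_forall fun x => ?_
      rw [Real.norm_of_nonneg (le_max_left _ _)]
      exact max_le (by positivity) (by nlinarith [sq_nonneg (u i x + v x)])
    · filter_upwards [hlim] with x hx
      have h := (tendsto_const_nhds (x := (0 : ℝ))).max
        ((tendsto_const_nhds (x := 4 * v x ^ 2)).sub ((hx.add_const (v x)).pow 2))
      convert h using 2
      rw [show 4 * v x ^ 2 - (v x + v x) ^ 2 = 0 by ring, max_self]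
  rw [integral_zero] at hdom
  refine tendsto_of_tendsto_of_tendsto_of_le_of_le' tendsto_const_nhds hdom
    (Eventually.of_forall fun i => integral_nonneg fun x => sq_nonneg _) ?_
  filter_upwards [hu, heq] with i hi hie
  have hadd := (hi.add hv).integrable_sq
  have hsub := (hi.sub hv).integrable_sq
  have hmax : Integrable (fun x => max 0 (4 * v x ^ 2 - (u i x + v x) ^ 2)) μ :=
    (integrable_zero _ _ _).sup ((hv.integrable_sq.const_mul 4).sub hadd)
  have hdiff : Integrable (fun x => 2 * (u i x ^ 2 - v x ^ 2)) μ :=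
    (hi.integrable_sq.sub hv.integrable_sq).const_mul 2
  have hzero : ∫ x, 2 * (u i x ^ 2 - v x ^ 2) ∂μ = 0 := by
    rw [integral_const_mul, integral_sub hi.integrable_sq hv.integrable_sq, hie, sub_self,
      mul_zero]
  calc ∫ x, (u i x - v x) ^ 2 ∂μ
      ≤ ∫ x, (2 * (u i x ^ 2 - v x ^ 2) + max 0 (4 * v x ^ 2 - (u i x + v x) ^ 2)) ∂μ := by
        refine integral_mono hsub (hdiff.add hmax) fun x => ?_
        have := le_max_right 0 (4 * v x ^ 2 - (u i x + v x) ^ 2)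
        dsimp only
        nlinarith
    _ = ∫ x, max 0 (4 * v x ^ 2 - (u i x + v x) ^ 2) ∂μ := by
        rw [integral_add hdiff hmax, hzero, zero_add]

/-- Convergence in `L²` implies convergence of the integrals against a fixed `L²` function. -/
theorem tendsto_integral_mul_of_tendsto_integral_sub_sq {w : α → ℝ}
    (hu : ∀ᶠ i in l, MemLp (u i) 2 μ) (hv : MemLp v 2 μ) (hw : MemLp w 2 μ)
    (hlim : Tendsto (fun i => ∫ x, (u i x - v x) ^ 2 ∂μ) l (nhds 0)) :
    Tendsto (fun i => ∫ x, w x * u i x ∂μ) l (nhds (∫ x, w x * v x ∂μ)) := by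
  rw [Metric.tendsto_nhds]
  intro ε hε
  set K := ∫ x, w x ^ 2 ∂μ
  have hK : 0 ≤ K := integral_nonneg fun x => sq_nonneg _
  set δ := ε / (K + 1) with hδ
  have hδ0 : 0 < δ := by positivity
  have hδK : δ * K < ε := by
    rw [hδ, div_mul_eq_mul_div, div_lt_iff₀ (by positivity)]
    nlinarith
  filter_upwards [hu, hlim.eventually (gt_mem_nhds (show 0 < δ * ε by positivity))] with i hi hM
  have hsub : Integrable (fun x => (u i x - v x) ^ 2) μ := (hi.sub hv).integrable_sq
  have hwu : Integrable (fun x => w x * u i x) μ := hw.integrable_mul hi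
  have hwv : Integrable (fun x => w x * v x) μ := hw.integrable_mul hv
  rw [Real.dist_eq, ← integral_sub hwu hwv]
  have hbound : |∫ x, (w x * u i x - w x * v x) ∂μ|
      ≤ ∫ x, (δ / 2 * w x ^ 2 + 1 / (2 * δ) * (u i x - v x) ^ 2) ∂μ := by
    rw [← Real.norm_eq_abs]
    refine norm_integral_le_of_norm_le
      ((hw.integrable_sq.const_mul _).add (hsub.const_mul _)) (Eventually.of_forall fun x => ?_)
    rw [← mul_sub, Real.norm_eq_abs, abs_mul, ← sq_abs (w x), ← sq_abs (u i x - v x)]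
    have h : δ / 2 * |w x| ^ 2 + 1 / (2 * δ) * |u i x - v x| ^ 2 - |w x| * |u i x - v x|
        = (δ * |w x| - |u i x - v x|) ^ 2 / (2 * δ) := by
      field_simp
      ring
    have : 0 ≤ (δ * |w x| - |u i x - v x|) ^ 2 / (2 * δ) := by positivity
    linarith
  have hM' : 1 / (2 * δ) * ∫ x, (u i x - v x) ^ 2 ∂μ < ε / 2 := by
    rw [div_mul_eq_mul_div, one_mul, div_lt_iff₀ (by positivity)]
    linarith
  have hsplit : ∫ x, (δ / 2 * w x ^ 2 + 1 / (2 * δ) * (u i x - v x) ^ 2) ∂μ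
      = δ / 2 * K + 1 / (2 * δ) * ∫ x, (u i x - v x) ^ 2 ∂μ := by
    rw [integral_add (hw.integrable_sq.const_mul _) (hsub.const_mul _), integral_const_mul,
      integral_const_mul]
  linarith

end SquareIntegrable

/-- A continuous function on `[0,∞)` that decays exponentially is square integrable against any
polynomial weight `r ^ n`. -/
theorem integrableOn_pow_mul_sq_of_exp_decay {f : ℝ → ℝ} {C c : ℝ} (hc : 0 < c)
    (hf : ContinuousOn f (Ici 0)) (hdecay : ∀ r ≥ (1 : ℝ), |f r| ≤ C * Real.exp (-c * r))
    (n : ℕ) : IntegrableOn (fun r => r ^ n * f r ^ 2) (Ioi 0) := by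
  have hcont : ContinuousOn (fun r => r ^ n * f r ^ 2) (Ici 0) := by fun_prop
  rw [← Ioc_union_Ioi_eq_Ioi (zero_le_one' ℝ), integrableOn_union]
  refine ⟨((hcont.mono Icc_subset_Ici_self).integrableOn_Icc).mono_set Ioc_subset_Icc_self, ?_⟩
  have hexp : IntegrableOn (fun r : ℝ => C ^ 2 * (r ^ (n : ℝ) * Real.exp (-(2 * c) * r)))
      (Ioi 1) :=
    ((integrableOn_rpow_mul_exp_neg_mul_rpow (s := n) (p := 1) (b := 2 * c)
      (by linarith [n.cast_nonneg (α := ℝ)]) one_pos (by positivity)).congr_fun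
        (fun r _ => by simp only [Real.rpow_one]) measurableSet_Ioi).mono_set
      (Ioi_subset_Ioi zero_le_one) |>.const_mul _
  refine Integrable.mono' hexp ((hcont.mono fun r (hr : 1 < r) =>
    (zero_le_one.trans hr.le : (0 : ℝ) ≤ r)).aestronglyMeasurable measurableSet_Ioi) ?_
  filter_upwards [ae_restrict_mem measurableSet_Ioi] with r hr
  have hr1 : (1 : ℝ) < r := hr
  have hr0 : (0 : ℝ) ≤ r := by linarith
  rw [Real.norm_of_nonneg (by positivity), Real.rpow_natCast, ← sq_abs (f r)]
  calc r ^ n * |f r| ^ 2 ≤ r ^ n * (C * Real.exp (-c * r)) ^ 2 := by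
        gcongr
        exact hdecay r hr1.le
    _ = C ^ 2 * (r ^ n * Real.exp (-(2 * c) * r)) := by
        rw [mul_pow, ← Real.exp_nat_mul]
        push_cast
        ring_nf

/-- Green's identity on `(0,∞)` for the weight `r`, with the boundary terms vanishing: at `0` by
continuity up to the boundary, at `∞` by exponential decay. -/
theorem integral_mul_radial_wronskian_eq_zero {u v p q : ℝ → ℝ} {C c : ℝ} (hc : 0 < c)
    (hu : ContDiffOn ℝ 2 u (Ioi 0)) (hv : ContDiffOn ℝ 2 v (Ioi 0))
    (hu0 : ContinuousOn u (Ici 0)) (hv0 : ContinuousOn v (Ici 0))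
    (hdu0 : ContinuousOn (deriv u) (Ici 0)) (hdv0 : ContinuousOn (deriv v) (Ici 0))
    (hue : ∀ r ∈ Ioi (0 : ℝ), deriv (deriv u) r + (1 / r) * deriv u r = p r * u r)
    (hve : ∀ r ∈ Ioi (0 : ℝ), deriv (deriv v) r + (1 / r) * deriv v r = q r * v r)
    (hud : ∀ r ≥ (1 : ℝ), |u r| + |deriv u r| ≤ C * Real.exp (-c * r))
    (hvd : ∀ r ≥ (1 : ℝ), |v r| + |deriv v r| ≤ C * Real.exp (-c * r))
    (hint : IntegrableOn (fun r => (q r - p r) * (r * (u r * v r))) (Ioi 0)) :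
    ∫ r in Ioi (0 : ℝ), (q r - p r) * (r * (u r * v r)) = 0 := by
  have hderiv : ∀ {w : ℝ → ℝ}, ContDiffOn ℝ 2 w (Ioi 0) → ∀ r ∈ Ioi (0 : ℝ),
      HasDerivAt w (deriv w r) r ∧ HasDerivAt (deriv w) (deriv (deriv w) r) r := by
    intro w hw r hr
    have hnhds := isOpen_Ioi.mem_nhds hr
    refine ⟨((hw.differentiableOn (by norm_num)).differentiableAt hnhds).hasDerivAt, ?_⟩
    have h1 : ContDiffOn ℝ 1 (deriv w) (Ioi 0) :=
      hw.deriv_of_isOpen isOpen_Ioi (by norm_num)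
    exact ((h1.differentiableOn (by norm_num)).differentiableAt hnhds).hasDerivAt
  have hzero : Tendsto (fun r => r * (u r * deriv v r - deriv u r * v r)) atTop (nhds 0) := by
    have hexp : Tendsto (fun r : ℝ => C ^ 2 * (r * Real.exp (-c * r))) atTop (nhds 0) := by
      have h := (tendsto_rpow_mul_exp_neg_mul_atTop_nhds_zero 1 c hc).const_mul (C ^ 2)
      simpa only [Real.rpow_one, mul_zero] using h
    refine squeeze_zero_norm' ?_ hexp
    filter_upwards [eventually_ge_atTop 1] with r hr
    have hr0 : 0 ≤ r := by linarith
    set E := Real.exp (-c * r)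
    have hE0 : 0 < E := Real.exp_pos _
    have hE1 : E ≤ 1 := Real.exp_le_one_iff.2 (by nlinarith)
    have h1 := hud r hr
    have h2 := hvd r hr
    rw [Real.norm_eq_abs, abs_mul, abs_of_nonneg hr0]
    have h3 : |u r * deriv v r - deriv u r * v r|
        ≤ (|u r| + |deriv u r|) * (|v r| + |deriv v r|) := by
      refine (abs_sub _ _).trans ?_
      rw [abs_mul, abs_mul]
      nlinarith [mul_nonneg (abs_nonneg (u r)) (abs_nonneg (v r)),
        mul_nonneg (abs_nonneg (deriv u r)) (abs_nonneg (deriv v r))]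
    calc r * |u r * deriv v r - deriv u r * v r|
        ≤ r * ((C * E) * (C * E)) := by
          gcongr
          refine h3.trans (mul_le_mul h1 h2 (by positivity) (le_trans (by positivity) h1))
      _ = C ^ 2 * r * (E * E) := by ring
      _ ≤ C ^ 2 * r * (E * 1) := by gcongr
      _ = C ^ 2 * (r * E) := by ring
  have hcont : ContinuousOn (fun r => r * (u r * deriv v r - deriv u r * v r)) (Ici 0) := by
    fun_prop
  have h := integral_Ioi_of_hasDerivAt_of_tendsto (hcont 0 self_mem_Ici)
    (f' := fun r => (q r - p r) * (r * (u r * v r))) ?_ hint hzero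
  · simpa using h
  · intro r hr
    obtain ⟨hu1, hu2⟩ := hderiv hu r hr
    obtain ⟨hv1, hv2⟩ := hderiv hv r hr
    refine ((hasDerivAt_id r).mul ((hu1.mul hv2).sub (hu2.mul hv1))).congr_deriv ?_
    have hr0 : r ≠ 0 := ne_of_gt hr
    rw [eq_sub_of_add_eq (hue r hr), eq_sub_of_add_eq (hve r hr)]
    simp only [id, Pi.sub_apply, Pi.mul_apply]
    field_simp
    ring

/-- Feynman–Hellmann formula for the singular operator `𝔤(τ) = −∂_r² − (1/r)∂_r + (r−τ)²`:
if `z(τ,·)` is a family of normalized eigenfunctions (in `L²_r(ℝ₊)`) associated to `ζ(τ)`,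
depending smoothly on `τ ∈ (a,b)`, extending continuously to `[0,∞)` with Neumann condition
and with locally uniform exponential decay, then `ζ` is differentiable and
`ζ'(τ) = −2 ∫₀^∞ (r−τ) z(τ,r)² r dr`. -/
theorem feynman_hellmann (a b : ℝ) (ζ : ℝ → ℝ) (z zt : ℝ → ℝ → ℝ)
    (hzr : ∀ τ ∈ Ioo a b, ContDiffOn ℝ 2 (z τ) (Ioi 0))
    (hzt : ∀ τ ∈ Ioo a b, ∀ r ∈ Ioi (0:ℝ), HasDerivAt (fun σ => z σ r) (zt τ r) τ)
    (hztc : ∀ r ∈ Ioi (0:ℝ), ContinuousOn (fun τ => zt τ r) (Ioo a b))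
    (hode : ∀ τ ∈ Ioo a b, ∀ r ∈ Ioi (0:ℝ),
      -(deriv (deriv (z τ)) r) - (1 / r) * deriv (z τ) r + (r - τ) ^ 2 * z τ r
        = ζ τ * z τ r)
    (hnorm : ∀ τ ∈ Ioo a b, ∫ r in Ioi (0:ℝ), (z τ r) ^ 2 * r = 1)
    (hcont : ∀ τ ∈ Ioo a b, ContinuousOn (z τ) (Ici 0) ∧ ContinuousOn (deriv (z τ)) (Ici 0))
    (hneu : ∀ τ ∈ Ioo a b, Tendsto (deriv (z τ)) (nhdsWithin 0 (Ioi 0)) (nhds 0))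
    (hdecay : ∀ τ ∈ Ioo a b, ∃ ε > (0:ℝ), ∃ C > (0:ℝ), ∃ c > (0:ℝ),
      ∀ σ ∈ Ioo a b, |σ - τ| < ε → ∀ r ≥ (1:ℝ),
        |z σ r| + |deriv (z σ) r| + |zt σ r| ≤ C * Real.exp (-c * r)) :
    ∀ τ ∈ Ioo a b, HasDerivAt ζ
      (-2 * ∫ r in Ioi (0:ℝ), ((r - τ) * (z τ r) ^ 2) * r) τ := by
  intro τ hτ
  obtain ⟨ε, hε, C, -, c, hc, hdec⟩ := hdecay τ hτ
  set μ := volume.restrict (Ioi (0 : ℝ))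
  let U : ℝ → ℝ → ℝ := fun σ r => √r * z σ r
  have hsqrt : ∀ (σ σ' : ℝ), ∀ r ∈ Ioi (0 : ℝ), U σ r * U σ' r = r * (z σ r * z σ' r) := by
    intro σ σ' r hr
    linear_combination (z σ r * z σ' r) * Real.mul_self_sqrt (le_of_lt hr)
  have hUsq : ∀ σ, ∀ r ∈ Ioi (0 : ℝ), (z σ r) ^ 2 * r = U σ r ^ 2 := by
    intro σ r hr
    rw [sq (U σ r), hsqrt σ σ r hr]
    ring
  have hUint : ∀ σ ∈ Ioo a b, ∫ r, U σ r ^ 2 ∂μ = 1 := fun σ hσ => by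
    rw [← hnorm σ hσ]
    exact (setIntegral_congr_fun measurableSet_Ioi (hUsq σ)).symm
  have hUcont : ∀ σ ∈ Ioo a b, ContinuousOn (U σ) (Ici 0) := fun σ hσ =>
    Real.continuous_sqrt.continuousOn.mul (hcont σ hσ).1
  have hUmeas : ∀ σ ∈ Ioo a b, AEStronglyMeasurable (U σ) μ := fun σ hσ =>
    ((hUcont σ hσ).mono Ioi_subset_Ici_self).aestronglyMeasurable measurableSet_Ioi
  have hUmem : ∀ σ ∈ Ioo a b, MemLp (U σ) 2 μ := fun σ hσ =>
    (memLp_two_iff_integrable_sq (hUmeas σ hσ)).2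
      (.of_integral_ne_zero (by rw [hUint σ hσ]; exact one_ne_zero))
  have hrUmem : MemLp (fun r => r * U τ r) 2 μ := by
    refine (memLp_two_iff_integrable_sq
      (aestronglyMeasurable_id.mul (hUmeas τ hτ))).2 ?_
    refine (integrableOn_pow_mul_sq_of_exp_decay (C := C) hc (hcont τ hτ).1 (fun r hr => ?_) 3).congr_fun
      (fun r hr => ?_) measurableSet_Ioi
    · have := hdec τ hτ (by simpa using hε) r hr
      linarith [abs_nonneg (deriv (z τ) r), abs_nonneg (zt τ r)]
    · simp only [Pi.mul_apply, id, mul_pow]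
      rw [← hUsq τ r hr]
      ring
  have hmem : ∀ᶠ σ in nhds τ, σ ∈ Ioo a b := isOpen_Ioo.mem_nhds hτ
  have hUev : ∀ᶠ σ in nhds τ, MemLp (U σ) 2 μ := hmem.mono hUmem
  have hL2 : Tendsto (fun σ => ∫ r, (U σ r - U τ r) ^ 2 ∂μ) (nhds τ) (nhds 0) := by
    refine tendsto_integral_sub_sq_of_integral_sq_eq hUev (hUmem τ hτ) ?_ ?_
    · filter_upwards [hmem] with σ hσ
      rw [hUint σ hσ, hUint τ hτ]
    · filter_upwards [ae_restrict_mem measurableSet_Ioi] with r hr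
      exact (hzt τ hτ r hr).continuousAt.tendsto.const_mul _
  have hA := tendsto_integral_mul_of_tendsto_integral_sub_sq hUev (hUmem τ hτ) (hUmem τ hτ) hL2
  have hB := tendsto_integral_mul_of_tendsto_integral_sub_sq hUev (hUmem τ hτ) hrUmem hL2
  have hA1 : ∫ r, U τ r * U τ r ∂μ = 1 := by
    simpa only [sq] using hUint τ hτ
  have hlimit : 2 * ∫ r, r * U τ r * U τ r ∂μ = 2 * τ +
      2 * ∫ r in Ioi (0:ℝ), ((r - τ) * (z τ r) ^ 2) * r := by
    have h : ∫ r in Ioi (0:ℝ), ((r - τ) * (z τ r) ^ 2) * r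
        = ∫ r, (r * U τ r * U τ r - τ * (U τ r * U τ r)) ∂μ := by
      refine setIntegral_congr_fun measurableSet_Ioi fun r hr => ?_
      rw [mul_assoc r, hsqrt τ τ r hr]
      ring
    have hi1 : Integrable (fun r => U τ r * U τ r) μ := (hUmem τ hτ).integrable_mul (hUmem τ hτ)
    have hi2 : Integrable (fun r => r * U τ r * U τ r) μ := hrUmem.integrable_mul (hUmem τ hτ)
    rw [h, integral_sub hi2 (hi1.const_mul τ), integral_const_mul, hA1]
    ring
  rw [hA1] at hA
  have hgreen : ∀ᶠ σ in nhds τ, (ζ σ - ζ τ) * ∫ r, U τ r * U σ r ∂μ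
      = (σ - τ) * ((τ + σ) * (∫ r, U τ r * U σ r ∂μ) - 2 * ∫ r, r * U τ r * U σ r ∂μ) := by
    filter_upwards [hmem, Metric.ball_mem_nhds τ hε] with σ hσ hσε
    have hi1 : Integrable (fun r => U τ r * U σ r) μ := (hUmem τ hτ).integrable_mul (hUmem σ hσ)
    have hi2 : Integrable (fun r => r * U τ r * U σ r) μ := hrUmem.integrable_mul (hUmem σ hσ)
    have hcongr : EqOn (fun r => (ζ σ - ζ τ - (σ - τ) * (τ + σ)) * (U τ r * U σ r)
        + 2 * (σ - τ) * (r * U τ r * U σ r))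
        (fun r => (((r - τ) ^ 2 - ζ τ) - ((r - σ) ^ 2 - ζ σ)) * (r * (z σ r * z τ r)))
        (Ioi 0) := fun r hr => by
      dsimp only
      rw [mul_assoc r, hsqrt τ σ r hr]
      ring
    have hint := (hi1.const_mul (ζ σ - ζ τ - (σ - τ) * (τ + σ))).add
      (hi2.const_mul (2 * (σ - τ)))
    have hbound : ∀ σ' ∈ Ioo a b, |σ' - τ| < ε → ∀ r ≥ (1 : ℝ),
        |z σ' r| + |deriv (z σ') r| ≤ C * Real.exp (-c * r) := fun σ' hσ' hε' r hr =>
      (le_add_of_nonneg_right (abs_nonneg _)).trans (hdec σ' hσ' hε' r hr)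
    have h := integral_mul_radial_wronskian_eq_zero (p := fun r => (r - σ) ^ 2 - ζ σ)
      (q := fun r => (r - τ) ^ 2 - ζ τ) hc (hzr σ hσ) (hzr τ hτ)
      (hcont σ hσ).1 (hcont τ hτ).1 (hcont σ hσ).2 (hcont τ hτ).2
      (fun r hr => by linarith [hode σ hσ r hr]) (fun r hr => by linarith [hode τ hτ r hr])
      (hbound σ hσ (by simpa [Real.dist_eq] using hσε)) (hbound τ hτ (by simpa using hε))
      (IntegrableOn.congr_fun hint hcongr measurableSet_Ioi)
    rw [← setIntegral_congr_fun measurableSet_Ioi hcongr, integral_add (hi1.const_mul _)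
      (hi2.const_mul _), integral_const_mul, integral_const_mul] at h
    linear_combination h
  rw [hasDerivAt_iff_tendsto_slope]
  have hquot := (((tendsto_id.const_add τ).mul hA).sub (hB.const_mul 2)).div hA one_ne_zero
  have hval : ((τ + τ) * 1 - 2 * ∫ r, r * U τ r * U τ r ∂μ) / 1
      = -2 * ∫ r in Ioi (0:ℝ), ((r - τ) * (z τ r) ^ 2) * r := by
    rw [hlimit]
    ring
  rw [hval] at hquot
  refine (hquot.mono_left nhdsWithin_le_nhds).congr' ?_
  filter_upwards [nhdsWithin_le_nhds hgreen, nhdsWithin_le_nhds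
    (hA.eventually_ne one_ne_zero), self_mem_nhdsWithin] with σ hσ hne hστ
  have hστ' : σ - τ ≠ 0 := sub_ne_zero.2 hστ
  rw [slope_def_field, Pi.div_apply, div_eq_div_iff hne hστ']
  simp only [id]
  linear_combination -hσ
end

section
/- There exist x₀ > 0 and C > 0 such that for every x ∈ (−x₀, x₀) and every τ ≥ 1, the rescaled potential V_τ(x) = τ (√(2x + τ) − √τ)² satisfies |V_τ(x) − (x² − x³/τ + 5x⁴/(4τ²))| ≤ C |x|⁵ / τ³. -/
open Set

/-- Fourth-order Taylor estimate for `√(1 + 2y)` near `0`. -/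
lemma abs_sqrt_one_add_two_mul_sub_taylor_le {y : ℝ} (hy : |y| ≤ 1 / 4) :
    |Real.sqrt (1 + 2 * y) - (1 + y - y ^ 2 / 2 + y ^ 3 / 2 - 5 / 8 * y ^ 4)| ≤ 8 * |y| ^ 5 := by
  obtain ⟨h1, h2⟩ := abs_le.mp hy
  set s := Real.sqrt (1 + 2 * y) with hs
  set P := 1 + y - y ^ 2 / 2 + y ^ 3 / 2 - 5 / 8 * y ^ 4 with hP
  have hs0 : 0 ≤ s := Real.sqrt_nonneg _
  have hss : s ^ 2 = 1 + 2 * y := Real.sq_sqrt (by linarith)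
  have y2 : y ^ 2 ≤ 1 / 16 := by nlinarith
  have y3 : |y ^ 3| ≤ 1 / 64 := by
    rw [abs_pow]
    calc |y| ^ 3 ≤ (1 / 4) ^ 3 := by gcongr
      _ = 1 / 64 := by norm_num
  obtain ⟨y3l, y3u⟩ := abs_le.mp y3
  have y4 : y ^ 4 ≤ 1 / 16 := by nlinarith [sq_nonneg y]
  have hP2 : 1 / 2 ≤ P := by linarith
  have key : (s - P) * (s + P) = y ^ 5 * (7 / 4 - 7 / 8 * y + 5 / 8 * y ^ 2 - 25 / 64 * y ^ 3) := by
    have : (s - P) * (s + P) = s ^ 2 - P ^ 2 := by ring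
    rw [this, hss, hP]; ring
  have hQ : |7 / 4 - 7 / 8 * y + 5 / 8 * y ^ 2 - 25 / 64 * y ^ 3| ≤ 4 :=
    abs_le.mpr ⟨by nlinarith [sq_nonneg y], by linarith⟩
  have hsum : 1 / 2 ≤ s + P := by linarith
  have h := congrArg abs key
  rw [abs_mul, abs_mul, abs_pow, abs_of_pos (by linarith : 0 < s + P)] at h
  have hl := mul_le_mul_of_nonneg_left hsum (abs_nonneg (s - P))
  have hr := mul_le_mul_of_nonneg_left hQ (pow_nonneg (abs_nonneg y) 5)
  linarith

/-- Expansion of the rescaled potential `V_τ(x) = τ(√(2x+τ) − √τ)²`: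
there exist `x₀ > 0` and `C > 0` such that for all `x ∈ (−x₀, x₀)` and `τ ≥ 1`,
`|V_τ(x) − (x² − x³/τ + 5x⁴/(4τ²))| ≤ C |x|⁵/τ³`. -/
theorem potential_expansion :
    ∃ x₀ > (0:ℝ), ∃ C > (0:ℝ), ∀ x ∈ Ioo (-x₀) x₀, ∀ τ : ℝ, 1 ≤ τ →
      |τ * (Real.sqrt (2 * x + τ) - Real.sqrt τ) ^ 2
        - (x ^ 2 - x ^ 3 / τ + 5 * x ^ 4 / (4 * τ ^ 2))|
      ≤ C * |x| ^ 5 / τ ^ 3 := by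
  refine ⟨1 / 4, by norm_num, 16, by norm_num, fun x hx τ hτ => ?_⟩
  have hτ0 : 0 < τ := by linarith
  obtain ⟨y, rfl⟩ : ∃ y, x = τ * y := ⟨x / τ, by field_simp⟩
  have hx' : τ * |y| < 1 / 4 := by
    have := abs_lt.mpr hx
    rwa [abs_mul, abs_of_pos hτ0] at this
  have hy : |y| ≤ 1 / 4 := by nlinarith [abs_nonneg y]
  have hmain := abs_sqrt_one_add_two_mul_sub_taylor_le hy
  have hsq : Real.sqrt (2 * (τ * y) + τ) = Real.sqrt τ * Real.sqrt (1 + 2 * y) := by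
    rw [← Real.sqrt_mul hτ0.le]; ring_nf
  have hss : Real.sqrt (1 + 2 * y) ^ 2 = 1 + 2 * y :=
    Real.sq_sqrt (by linarith [(abs_le.mp hy).1])
  rw [hsq]
  set s := Real.sqrt (1 + 2 * y)
  have hV : τ * (Real.sqrt τ * s - Real.sqrt τ) ^ 2 = τ ^ 2 * (2 + 2 * y - 2 * s) := by
    calc τ * (Real.sqrt τ * s - Real.sqrt τ) ^ 2
        = τ * Real.sqrt τ ^ 2 * (s ^ 2 - 2 * s + 1) := by ring
      _ = τ ^ 2 * (2 + 2 * y - 2 * s) := by rw [Real.sq_sqrt hτ0.le, hss]; ring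
  have hdiff : τ * (Real.sqrt τ * s - Real.sqrt τ) ^ 2
      - ((τ * y) ^ 2 - (τ * y) ^ 3 / τ + 5 * (τ * y) ^ 4 / (4 * τ ^ 2))
      = -(2 * τ ^ 2) * (s - (1 + y - y ^ 2 / 2 + y ^ 3 / 2 - 5 / 8 * y ^ 4)) := by
    rw [hV]; field_simp; ring
  have hR : 16 * |τ * y| ^ 5 / τ ^ 3 = 2 * τ ^ 2 * (8 * |y| ^ 5) := by
    rw [abs_mul, abs_of_pos hτ0]; field_simp; ring
  rw [hdiff, hR, abs_mul, abs_neg, abs_of_pos (by positivity : 0 < 2 * τ ^ 2)]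
  gcongr
end
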